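/- Let (X, μ) be a σ-finite measure space and 2 ≤ p < ∞. Suppose T : L^p(X, μ) → L^p(X, μ) belongs to the closure, with respect to the strong operator topology (pointwise norm convergence on L^p(X, μ)), of the convex hull of the set of all Lamperti contractions on L^p(X, μ). Then there exists a constant C depending only on p such that for every N ∈ ℕ, every strictly increasing finite sequence n_0 < n_1 < ⋯ < n_N of positive integers, and every x ∈ L^p(X, μ), one has ‖ ( ∑_{i=0}^{N-1} |M_{n_i}(T)x − M_{n_{i+1}}(T)x|^2 )^{1/2} ‖_{L^p(X,μ)} ≤ C ‖x‖_{L^p(X,μ)}. (This is the commutative case of Theorem 1.3 for 2 ≤ p < ∞.) -/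

import Mathlib

open MeasureTheory Finset ENNReal

/-- One-sided ergodic average `M_n(T) = (1/(n+1)) ∑_{k=0}^{n} T^k`. -/
noncomputable def ergAvg {X : Type*} [MeasurableSpace X] {μ : MeasureTheory.Measure X}
    {p : ℝ≥0∞} [Fact (1 ≤ p)]
    (T : Lp ℂ p μ →L[ℂ] Lp ℂ p μ) (n : ℕ) : Lp ℂ p μ →L[ℂ] Lp ℂ p μ :=
  ((n : ℂ) + 1)⁻¹ • ∑ k ∈ Finset.range (n + 1), T ^ k

/-- A bounded operator on `L^p(X, μ)` is Lamperti (disjointness preserving) if it maps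
μ-a.e. disjointly supported pairs of functions to μ-a.e. disjointly supported pairs. -/
def IsLamperti {X : Type*} [MeasurableSpace X] {μ : MeasureTheory.Measure X}
    {p : ℝ≥0∞} [Fact (1 ≤ p)]
    (S : Lp ℂ p μ →L[ℂ] Lp ℂ p μ) : Prop :=
  ∀ f g : Lp ℂ p μ, (∀ᵐ ω ∂μ, (f : X → ℂ) ω * (g : X → ℂ) ω = 0) →
    (∀ᵐ ω ∂μ, (S f : X → ℂ) ω * (S g : X → ℂ) ω = 0)

namespace QME

/-- Averaging over the classes of level `d`. -/
noncomputable def cE (Ω : Finset ℕ) (π : ℕ → ℕ → ℕ) (d : ℕ) (f : ℕ → ℝ) (x : ℕ) : ℝ :=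
  (∑ y ∈ Ω with π d y = π d x, f y) / ((Ω.filter (fun y => π d y = π d x)).card : ℝ)

section mart
variable {Ω : Finset ℕ} {π : ℕ → ℕ → ℕ}

lemma cE_congr {d : ℕ} (f : ℕ → ℝ) {x y : ℕ} (h : π d x = π d y) :
    cE Ω π d f x = cE Ω π d f y := by
  unfold cE; rw [h]

lemma cE_nonneg {d : ℕ} {f : ℕ → ℝ} (hf : ∀ x, 0 ≤ f x) (x : ℕ) : 0 ≤ cE Ω π d f x := by
  unfold cE; exact div_nonneg (Finset.sum_nonneg fun _ _ => hf _) (by positivity)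

lemma cE_sum (d : ℕ) (f g : ℕ → ℝ) (hg : ∀ x y, π d x = π d y → g x = g y) :
    ∑ x ∈ Ω, cE Ω π d f x * g x = ∑ x ∈ Ω, f x * g x := by
  have h1 : ∀ x ∈ Ω, cE Ω π d f x * g x = ∑ y ∈ Ω, if π d y = π d x then
      f y * g y / ((Ω.filter (fun z => π d z = π d y)).card : ℝ) else 0 := by
    intro x _
    rw [cE, ← Finset.sum_filter, Finset.sum_div, Finset.sum_mul]
    apply Finset.sum_congr rfl
    intro y hy
    have hy2 := (Finset.mem_filter.1 hy).2
    rw [hg x y hy2.symm, hy2]; ring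
  rw [Finset.sum_congr rfl h1, Finset.sum_comm]
  apply Finset.sum_congr rfl
  intro y hy
  rw [← Finset.sum_filter, Finset.sum_const, nsmul_eq_mul]
  have : (Ω.filter (fun x => π d y = π d x)) = (Ω.filter (fun x => π d x = π d y)) := by
    ext; simp [eq_comm]
  rw [this]
  have hc : ((Ω.filter (fun z => π d z = π d y)).card : ℝ) ≠ 0 := by
    have : y ∈ Ω.filter (fun z => π d z = π d y) := by simp [hy]
    exact_mod_cast (Finset.card_pos.2 ⟨y, this⟩).ne'
  field_simp

lemma cE_selfadj (d : ℕ) (f g : ℕ → ℝ) :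
    ∑ x ∈ Ω, cE Ω π d f x * g x = ∑ x ∈ Ω, f x * cE Ω π d g x := by
  rw [← cE_sum d f (cE Ω π d g) (fun x y h => cE_congr g h)]
  rw [Finset.sum_congr rfl (fun x _ => mul_comm _ _),
    ← cE_sum d g (cE Ω π d f) (fun x y h => cE_congr f h)]
  exact Finset.sum_congr rfl (fun x _ => mul_comm _ _)

lemma cE_class_sum (d : ℕ) (f : ℕ → ℝ) (c : ℕ) :
    ∑ x ∈ Ω with π d x = c, cE Ω π d f x = ∑ x ∈ Ω with π d x = c, f x := by
  have := cE_sum (Ω := Ω) (π := π) d f (fun x => if π d x = c then 1 else 0)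
    (fun x y h => by simp [h])
  simpa [Finset.sum_filter] using this

lemma nest_le (hπ : ∀ d x y, π (d+1) x = π (d+1) y → π d x = π d y) {d e : ℕ} (hde : d ≤ e)
    {x y : ℕ} (h : π e x = π e y) : π d x = π d y := by
  induction e, hde using Nat.le_induction with
  | base => exact h
  | succ e _ ih => exact ih (hπ _ _ _ h)

lemma pyth (hπ : ∀ d x y, π (d+1) x = π (d+1) y → π d x = π d y) {d e : ℕ} (hde : d ≤ e)
    (f w : ℕ → ℝ) (hw : ∀ x y, π d x = π d y → w x = w y) :
    ∑ x ∈ Ω, w x * (cE Ω π e f x - cE Ω π d f x)^2 =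
      ∑ x ∈ Ω, w x * ((cE Ω π e f x)^2 - (cE Ω π d f x)^2) := by
  have hm : ∀ x y, π d x = π d y → w x * cE Ω π d f x = w y * cE Ω π d f y := by
    intro x y h; rw [hw x y h, cE_congr f h]
  have h1 := cE_sum (Ω := Ω) (π := π) d f (fun x => w x * cE Ω π d f x) hm
  have h2 := cE_sum (Ω := Ω) (π := π) e f (fun x => w x * cE Ω π d f x)
    (fun x y h => hm x y (nest_le hπ hde h))
  have : ∑ x ∈ Ω, w x * (cE Ω π e f x - cE Ω π d f x)^2 -
      ∑ x ∈ Ω, w x * ((cE Ω π e f x)^2 - (cE Ω π d f x)^2)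
      = 2 * (∑ x ∈ Ω, cE Ω π d f x * (w x * cE Ω π d f x)) -
        2 * ∑ x ∈ Ω, cE Ω π e f x * (w x * cE Ω π d f x) := by
    rw [Finset.mul_sum, Finset.mul_sum, ← Finset.sum_sub_distrib, ← Finset.sum_sub_distrib]
    exact Finset.sum_congr rfl (fun x _ => by ring)
  rw [h1, h2] at this
  linarith

/-- Running maximal function. -/
noncomputable def mV (Ω : Finset ℕ) (π : ℕ → ℕ → ℕ) (h : ℕ → ℝ) : ℕ → ℕ → ℝ
  | 0, x => cE Ω π 0 h x
  | d + 1, x => max (mV Ω π h d x) (cE Ω π (d+1) h x)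

lemma mV_mono (h : ℕ → ℝ) (x : ℕ) : Monotone (fun d => mV Ω π h d x) :=
  monotone_nat_of_le_succ (fun _ => le_max_left _ _)

lemma le_mV_self (h : ℕ → ℝ) (d x : ℕ) : cE Ω π d h x ≤ mV Ω π h d x := by
  cases d with
  | zero => exact le_rfl
  | succ d => exact le_max_right _ _

lemma le_mV (h : ℕ → ℝ) {d e : ℕ} (hde : d ≤ e) (x : ℕ) : cE Ω π d h x ≤ mV Ω π h e x :=
  (le_mV_self h d x).trans (mV_mono h x hde)

lemma mV_nonneg {h : ℕ → ℝ} (hh : ∀ x, 0 ≤ h x) (d x : ℕ) : 0 ≤ mV Ω π h d x :=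
  (cE_nonneg hh x).trans (le_mV_self h d x)

lemma mV_congr (hπ : ∀ d x y, π (d+1) x = π (d+1) y → π d x = π d y) (h : ℕ → ℝ) (d : ℕ) :
    ∀ x y, π d x = π d y → mV Ω π h d x = mV Ω π h d y := by
  induction d with
  | zero => intro x y hxy; exact cE_congr h hxy
  | succ d ih =>
    intro x y hxy
    simp only [mV]
    rw [ih x y (hπ _ _ _ hxy), cE_congr h hxy]

/-- weighted martingale inequality -/
lemma M1 (hπ : ∀ d x y, π (d+1) x = π (d+1) y → π d x = π d y) (f : ℕ → ℝ) {h : ℕ → ℝ}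
    (D : ℕ) :
    ∑ d ∈ range D, ∑ x ∈ Ω, mV Ω π h d x * (cE Ω π (d+1) f x - cE Ω π d f x)^2 ≤
      ∑ x ∈ Ω, mV Ω π h D x * (cE Ω π D f x)^2 - ∑ x ∈ Ω, mV Ω π h 0 x * (cE Ω π 0 f x)^2 := by
  induction D with
  | zero => simp
  | succ D ih =>
    rw [Finset.sum_range_succ, pyth hπ (Nat.le_succ D) f _ (mV_congr hπ h D)]
    have : ∑ x ∈ Ω, mV Ω π h D x * (cE Ω π (D+1) f x)^2 ≤
      ∑ x ∈ Ω, mV Ω π h (D+1) x * (cE Ω π (D+1) f x)^2 :=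
      Finset.sum_le_sum fun x _ => mul_le_mul_of_nonneg_right (mV_mono h x (Nat.le_succ D))
        (sq_nonneg _)
    simp only [mul_sub, Finset.sum_sub_distrib] at *
    linarith

lemma abs_cE_le (d : ℕ) (f : ℕ → ℝ) (x : ℕ) : |cE Ω π d f x| ≤ cE Ω π d (fun y => |f y|) x := by
  unfold cE
  rw [abs_div, Nat.abs_cast]
  gcongr
  exact Finset.abs_sum_le_sum_abs _ _

/-- weighted inequality for long jumps -/
lemma M2 (hπ : ∀ d x y, π (d+1) x = π (d+1) y → π d x = π d y) (f : ℕ → ℝ) {h : ℕ → ℝ}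
    (D : ℕ) (s : ℕ → ℕ) (hs : Antitone s) (hsD : ∀ i, s i ≤ D) (N : ℕ) :
    ∑ i ∈ range N, ∑ x ∈ Ω, mV Ω π h (s i) x * (cE Ω π (s i) f x - cE Ω π (s (i+1)) f x)^2 ≤
      ∑ x ∈ Ω, mV Ω π h (s 0) x *
        ((cE Ω π (s 0) f x)^2 + 4 * (mV Ω π (fun y => |f y|) D x)^2)
      - ∑ x ∈ Ω, mV Ω π h (s N) x *
        ((cE Ω π (s N) f x)^2 + 4 * (mV Ω π (fun y => |f y|) D x)^2) := by
  induction N with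
  | zero => simp
  | succ N ih =>
    rw [Finset.sum_range_succ]
    have hle : s (N+1) ≤ s N := hs (Nat.le_succ N)
    have e1 := pyth (Ω := Ω) hπ hle f _ (mV_congr (Ω := Ω) hπ h (s (N+1)))
    have e2 : ∑ x ∈ Ω, (mV Ω π h (s N) x * (cE Ω π (s N) f x - cE Ω π (s (N+1)) f x)^2
        - mV Ω π h (s (N+1)) x * (cE Ω π (s N) f x - cE Ω π (s (N+1)) f x)^2)
        ≤ ∑ x ∈ Ω, (mV Ω π h (s N) x - mV Ω π h (s (N+1)) x) *
          (4 * (mV Ω π (fun y => |f y|) D x)^2) := by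
      refine Finset.sum_le_sum fun x _ => ?_
      rw [← sub_mul]
      refine mul_le_mul_of_nonneg_left ?_ (sub_nonneg.2 (mV_mono h x hle))
      have a1 := abs_le.1 ((abs_cE_le (Ω := Ω) (π := π) (s N) f x).trans (le_mV _ (hsD N) x))
      have a2 := abs_le.1 ((abs_cE_le (Ω := Ω) (π := π) (s (N+1)) f x).trans (le_mV _ (hsD _) x))
      nlinarith
    have e3 : ∑ x ∈ Ω, mV Ω π h (s (N+1)) x * (cE Ω π (s N) f x)^2 ≤
       ∑ x ∈ Ω, mV Ω π h (s N) x * (cE Ω π (s N) f x)^2 :=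
      Finset.sum_le_sum fun x _ => mul_le_mul_of_nonneg_right (mV_mono h x hle)
        (sq_nonneg _)
    simp only [mul_sub, sub_mul, mul_add, Finset.sum_sub_distrib, Finset.sum_add_distrib] at *
    linarith

lemma doob_scalar {r A B : ℝ} (hr : 1 < r) (hB : 0 ≤ B) (hAB : B ≤ A) :
    A^r - B^r ≤ r/(r-1) * ((A^(r-1) - B^(r-1)) * A) := by
  have hA := hB.trans hAB
  have hr1 : 0 < r - 1 := by linarith
  have hpq : r.HolderConjugate (r/(r-1)) := Real.HolderConjugate.conjExponent hr
  have y := Real.young_inequality_of_nonneg hA (Real.rpow_nonneg hB (r-1)) hpq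
  rw [← Real.rpow_mul hB, show (r-1)*(r/(r-1)) = r by field_simp] at y
  have hAr : A^(r-1) * A = A^r := by
    rw [← Real.rpow_add_one' hA (by linarith)]; ring_nf
  rw [sub_mul, hAr]
  have : r/(r-1) * (A * B^(r-1)) ≤ r/(r-1) * (A^r/r + B^r/(r/(r-1))) :=
    mul_le_mul_of_nonneg_left y (by positivity)
  have e : r/(r-1) * (A^r/r + B^r/(r/(r-1))) = A^r/(r-1) + B^r := by field_simp
  have e' : r/(r-1) * A^r = A^r + A^r/(r-1) := by field_simp; ring
  rw [mul_sub, e', mul_comm (B^(r-1)) A]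
  linarith

lemma doob1 (hπ : ∀ d x y, π (d+1) x = π (d+1) y → π d x = π d y) {h : ℕ → ℝ}
    (hh : ∀ x, 0 ≤ h x) {r : ℝ} (hr : 1 < r) (D : ℕ) :
    ∑ x ∈ Ω, (mV Ω π h D x)^r ≤ r/(r-1) * ∑ x ∈ Ω, h x * (mV Ω π h D x)^(r-1) := by
  have hr1 : 0 < r - 1 := by linarith
  induction D with
  | zero =>
    have : ∑ x ∈ Ω, (mV Ω π h 0 x)^r = ∑ x ∈ Ω, h x * (mV Ω π h 0 x)^(r-1) := by
      rw [← cE_sum 0 h _ (fun x y hxy => by rw [mV_congr hπ h 0 x y hxy])]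
      refine Finset.sum_congr rfl fun x _ => ?_
      change (mV Ω π h 0 x)^r = mV Ω π h 0 x * _
      rw [mul_comm, ← Real.rpow_add_one' (mV_nonneg hh 0 x) (by linarith)]; ring_nf
    rw [this]
    refine le_mul_of_one_le_left (Finset.sum_nonneg fun x _ => mul_nonneg (hh x)
      (Real.rpow_nonneg (mV_nonneg hh 0 x) _)) ?_
    rw [le_div_iff₀ hr1]; linarith
  | succ D ih =>
    have e1 : ∑ x ∈ Ω, ((mV Ω π h (D+1) x)^r - (mV Ω π h D x)^r) ≤
      ∑ x ∈ Ω, r/(r-1) * (cE Ω π (D+1) h x * ((mV Ω π h (D+1) x)^(r-1) - (mV Ω π h D x)^(r-1))) := by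
      refine Finset.sum_le_sum fun x _ => ?_
      rcases le_total (cE Ω π (D+1) h x) (mV Ω π h D x) with hc | hc
      · simp [mV, max_eq_left hc]
      · simp only [mV, max_eq_right hc]
        have := doob_scalar hr (mV_nonneg hh D x) hc
        rwa [mul_comm _ (cE Ω π (D+1) h x)] at this
    rw [← Finset.mul_sum, cE_sum (D+1) h _ (fun x y hxy => by
      rw [mV_congr hπ h (D+1) x y hxy, mV_congr hπ h D x y (hπ _ _ _ hxy)])] at e1
    simp only [mul_sub, Finset.sum_sub_distrib] at *
    linarith

lemma doob (hπ : ∀ d x y, π (d+1) x = π (d+1) y → π d x = π d y) {h : ℕ → ℝ}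
    (hh : ∀ x, 0 ≤ h x) {r : ℝ} (hr : 1 < r) (D : ℕ) :
    ∑ x ∈ Ω, (mV Ω π h D x)^r ≤ (r/(r-1))^r * ∑ x ∈ Ω, (h x)^r := by
  have hr1 : 0 < r - 1 := by linarith
  have hpq : r.HolderConjugate (r/(r-1)) := Real.HolderConjugate.conjExponent hr
  have h1 := doob1 (Ω := Ω) hπ hh hr D
  have hol := Real.inner_le_Lp_mul_Lq_of_nonneg Ω hpq (f := h)
    (g := fun x => (mV Ω π h D x)^(r-1)) (fun x _ => hh x)
    (fun x _ => Real.rpow_nonneg (mV_nonneg hh D x) _)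
  have e : ∀ x, ((mV Ω π h D x)^(r-1))^(r/(r-1)) = (mV Ω π h D x)^r := fun x => by
    rw [← Real.rpow_mul (mV_nonneg hh D x), show (r-1)*(r/(r-1)) = r by field_simp]
  simp only [e] at hol
  set S := ∑ x ∈ Ω, (mV Ω π h D x)^r with hS
  set B := ∑ x ∈ Ω, (h x)^r with hB
  have hS0 : 0 ≤ S := Finset.sum_nonneg fun x _ => Real.rpow_nonneg (mV_nonneg hh D x) _
  have hB0 : 0 ≤ B := Finset.sum_nonneg fun x _ => Real.rpow_nonneg (hh x) _
  have hc : 0 < r/(r-1) := by positivity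
  rcases hS0.eq_or_lt with h0 | h0
  · rw [← h0]; positivity
  have h2 : S ≤ r/(r-1) * (B^(1/r) * S^(1/(r/(r-1)))) :=
    h1.trans (mul_le_mul_of_nonneg_left hol hc.le)
  have h3 : S = S^(1/r) * S^(1/(r/(r-1))) := by
    rw [← Real.rpow_add h0]
    have : 1/r + 1/(r/(r-1)) = 1 := by field_simp; ring
    rw [this, Real.rpow_one]
  have h4 : S^(1/r) ≤ r/(r-1) * B^(1/r) := by
    have hp : 0 < S^(1/(r/(r-1))) := Real.rpow_pos_of_pos h0 _
    rw [← mul_assoc] at h2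
    nth_rewrite 1 [h3] at h2
    exact le_of_mul_le_mul_right h2 hp
  have h5 := Real.rpow_le_rpow (by positivity) h4 (by linarith : 0 ≤ r)
  rw [Real.mul_rpow hc.le (by positivity), ← Real.rpow_mul hS0, ← Real.rpow_mul hB0,
    one_div_mul_cancel (by linarith), Real.rpow_one, Real.rpow_one] at h5
  exact h5

end mart
end QME

namespace QME

/-- multi-scale remainder -/
noncomputable def Dt (Ω : Finset ℕ) (π : ℕ → ℕ → ℕ) (J : ℕ) (f : ℕ → ℝ) (e x : ℕ) : ℝ :=
  ∑ j ∈ Ico e J, (2/3 : ℝ)^(j-e) *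
    cE Ω π e (fun y => (cE Ω π (j+1) f y - cE Ω π j f y)^2) x

lemma Dt_nonneg (Ω : Finset ℕ) (π : ℕ → ℕ → ℕ) (J : ℕ) (f : ℕ → ℝ) (e x : ℕ) :
    0 ≤ Dt Ω π J f e x :=
  Finset.sum_nonneg fun _ _ => mul_nonneg (by positivity) (cE_nonneg (fun _ => sq_nonneg _) _)

lemma geom_le (q : ℝ) (h0 : 0 ≤ q) (h1 : q < 1) (n : ℕ) : ∑ i ∈ range n, q^i ≤ (1-q)⁻¹ := by
  rw [← tsum_geometric_of_lt_one h0 h1]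
  exact (summable_geometric_of_lt_one h0 h1).sum_le_tsum _ (fun _ _ => by positivity)

lemma M3 {Ω : Finset ℕ} {π : ℕ → ℕ → ℕ}
    (hπ : ∀ d x y, π (d+1) x = π (d+1) y → π d x = π d y) (f : ℕ → ℝ) {h : ℕ → ℝ}
    (hh : ∀ x, 0 ≤ h x) (J : ℕ) :
    ∑ e ∈ range J, ∑ x ∈ Ω, h x * Dt Ω π J f e x ≤
      3 * ∑ x ∈ Ω, mV Ω π h J x * (cE Ω π J f x)^2 := by
  set G : ℕ → ℝ := fun j => ∑ x ∈ Ω, mV Ω π h j x * (cE Ω π (j+1) f x - cE Ω π j f x)^2 with hG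
  have hG0 : ∀ j, 0 ≤ G j := fun j => Finset.sum_nonneg fun x _ =>
    mul_nonneg (mV_nonneg hh j x) (sq_nonneg _)
  have h1 : ∀ e ∈ range J, ∑ x ∈ Ω, h x * Dt Ω π J f e x ≤
      ∑ j ∈ Ico e J, (2/3 : ℝ)^(j-e) * G j := by
    intro e _
    simp only [Dt, Finset.mul_sum]
    rw [Finset.sum_comm]
    refine Finset.sum_le_sum fun j hj => ?_
    rw [hG, Finset.mul_sum]
    have hej := (Finset.mem_Ico.1 hj).1
    calc _ = (2/3 : ℝ)^(j-e) * ∑ x ∈ Ω, h x *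
          cE Ω π e (fun y => (cE Ω π (j+1) f y - cE Ω π j f y)^2) x := by
            rw [Finset.mul_sum]; exact Finset.sum_congr rfl fun _ _ => by ring
      _ = (2/3 : ℝ)^(j-e) * ∑ x ∈ Ω, cE Ω π e h x * (cE Ω π (j+1) f x - cE Ω π j f x)^2 := by
            rw [cE_selfadj]
      _ ≤ _ := by
            rw [← Finset.mul_sum]
            refine mul_le_mul_of_nonneg_left (Finset.sum_le_sum fun x _ => ?_) (by positivity)
            exact mul_le_mul_of_nonneg_right (le_mV h hej x) (sq_nonneg _)
  refine (Finset.sum_le_sum h1).trans ?_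
  have h2 : ∑ e ∈ range J, ∑ j ∈ Ico e J, (2/3 : ℝ)^(j-e) * G j =
      ∑ j ∈ range J, ∑ e ∈ range (j+1), (2/3 : ℝ)^(j-e) * G j := by
    apply Finset.sum_comm'
    intro x y; simp; omega
  rw [h2]
  have h3 : ∀ j ∈ range J, ∑ e ∈ range (j+1), (2/3 : ℝ)^(j-e) * G j ≤ 3 * G j := by
    intro j _
    rw [← Finset.sum_mul]
    refine mul_le_mul_of_nonneg_right ?_ (hG0 j)
    have := Finset.sum_range_reflect (fun i => (2/3 : ℝ)^i) (j+1)
    simp only [Nat.add_sub_cancel] at this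
    rw [this]
    exact (geom_le _ (by norm_num) (by norm_num) _).trans (by norm_num)
  refine (Finset.sum_le_sum h3).trans ?_
  rw [← Finset.mul_sum]
  have := M1 (Ω := Ω) hπ f (h := h) J
  have h5 : 0 ≤ ∑ x ∈ Ω, mV Ω π h 0 x * (cE Ω π 0 f x)^2 := Finset.sum_nonneg fun x _ =>
    mul_nonneg (mV_nonneg hh 0 x) (sq_nonneg _)
  linarith

/-- numeric lemma -/
lemma numP {ι : Type*} (I : Finset ι) (e J : ℕ) (y : ι → ℝ) (x : ι → ℕ → ℝ) (c : ℕ → ℝ) (B : ℝ)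
    (hy : ∀ i ∈ I, y i = ∑ j ∈ Ico e J, x i j)
    (hx : ∀ j ∈ Ico e J, ∑ i ∈ I, (x i j)^2 ≤ B * ((1/2 : ℝ)^(j-e) * c j)) :
    ∑ i ∈ I, (y i)^2 ≤ 4 * B * ∑ j ∈ Ico e J, (2/3 : ℝ)^(j-e) * c j := by
  have h1 : ∀ i ∈ I, (y i)^2 ≤ 4 * ∑ j ∈ Ico e J, (4/3 : ℝ)^(j-e) * (x i j)^2 := by
    intro i hi
    rw [hy i hi]
    have h := Finset.sum_sq_le_sum_mul_sum_of_sq_le_mul (Ico e J) (r := fun j => x i j)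
      (f := fun j => (3/4 : ℝ)^(j-e)) (g := fun j => (4/3 : ℝ)^(j-e) * (x i j)^2)
      (fun _ _ => by positivity) (fun _ _ => by positivity) (fun j _ => by
        rw [← mul_assoc, ← mul_pow]; norm_num)
    refine h.trans (mul_le_mul_of_nonneg_right ?_ (Finset.sum_nonneg fun _ _ => by positivity))
    rw [Finset.sum_Ico_eq_sum_range]
    simp only [Nat.add_sub_cancel_left]
    exact (geom_le _ (by norm_num) (by norm_num) _).trans (by norm_num)
  refine (Finset.sum_le_sum h1).trans ?_
  rw [← Finset.mul_sum, Finset.sum_comm, mul_assoc]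
  refine mul_le_mul_of_nonneg_left ?_ (by norm_num)
  rw [Finset.mul_sum]
  refine Finset.sum_le_sum fun j hj => ?_
  rw [← Finset.mul_sum]
  refine (mul_le_mul_of_nonneg_left (hx j hj) (by positivity)).trans (le_of_eq ?_)
  have : (2/3 : ℝ)^(j-e) = (4/3 : ℝ)^(j-e) * (1/2 : ℝ)^(j-e) := by rw [← mul_pow]; norm_num
  rw [this]; ring

/-- The dyadic grid with shift `c`. -/
def gr (J c d x : ℕ) : ℕ := (x + c) / 2^(J-d)

lemma gr_nest (J c : ℕ) : ∀ d x y, gr J c (d+1) x = gr J c (d+1) y → gr J c d x = gr J c d y := by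
  intro d x y h
  unfold gr at *
  by_cases hd : d < J
  · have : 2^(J-d) = 2^(J-(d+1)) * 2 := by rw [← pow_succ]; congr 1; omega
    rw [this, ← Nat.div_div_eq_div_mul, ← Nat.div_div_eq_div_mul, h]
  · have : J - d = J - (d+1) := by omega
    rw [this, h]

lemma gr_mono (J c d : ℕ) : Monotone (gr J c d) := fun x y h =>
  Nat.div_le_div_right (by omega)

lemma card_gr (M J c d v : ℕ) : ((range M).filter (fun y => gr J c d y = v)).card ≤ 2^(J-d) := by
  have hp : 0 < 2^(J-d) := by positivity
  have : ((range M).filter (fun y => gr J c d y = v)).card ≤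
      (Ico (v * 2^(J-d)) (v * 2^(J-d) + 2^(J-d))).card := by
    apply Finset.card_le_card_of_injOn (fun y => y + c)
    · intro y hy
      have hy := (Finset.mem_filter.1 hy).2
      unfold gr at hy
      simp only [coe_Ico, Set.mem_Ico]
      have e1 := Nat.div_add_mod (y+c) (2^(J-d))
      have e2 := Nat.mod_lt (y+c) hp
      rw [hy, mul_comm] at e1
      constructor <;> omega
    · intro a _ b _ h; simpa using h
  simpa using this

lemma cE_top (M J c : ℕ) (f : ℕ → ℝ) {x : ℕ} (hx : x < M) : cE (range M) (gr J c) J f x = f x := by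
  unfold cE
  have : (range M).filter (fun y => gr J c J y = gr J c J x) = {x} := by
    ext y; simp only [mem_filter, mem_range, mem_singleton, gr, Nat.sub_self, pow_zero, Nat.div_one]
    constructor
    · rintro ⟨_, h⟩; omega
    · rintro rfl; exact ⟨hx, rfl⟩
  rw [this]; simp

lemma kernel (M J c d u v : ℕ) (hv : v ≤ M) (g : ℕ → ℝ)
    (hg : ∀ w, ∑ x ∈ range M with gr J c d x = w, g x = 0) :
    (∑ x ∈ Ico u v, g x)^2 ≤ 2 * 2^(J-d) * ∑ x ∈ Ico u v, (g x)^2 := by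
  rcases Nat.lt_or_ge u v with huv | huv
  swap
  · simp [Finset.Ico_eq_empty_of_le huv]
  set B := (Ico u v).filter (fun x => gr J c d x = gr J c d u ∨ gr J c d x = gr J c d (v-1)) with hB
  have h1 : ∑ x ∈ Ico u v, g x = ∑ x ∈ B, g x := by
    rw [hB, ← Finset.sum_filter_add_sum_filter_not (Ico u v)
      (fun x => gr J c d x = gr J c d u ∨ gr J c d x = gr J c d (v-1)) g]
    simp only [add_eq_left]
    have : (Ico u v).filter (fun x => ¬ (gr J c d x = gr J c d u ∨ gr J c d x = gr J c d (v-1))) =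
      (range M).filter (fun x => gr J c d x ∈ Ioo (gr J c d u) (gr J c d (v-1))) := by
      ext x
      simp only [mem_filter, mem_Ico, mem_range, mem_Ioo, not_or]
      constructor
      · rintro ⟨⟨a1, a2⟩, a3, a4⟩
        refine ⟨by omega, lt_of_le_of_ne (gr_mono J c d a1) (Ne.symm a3),
          lt_of_le_of_ne (gr_mono J c d (by omega)) a4⟩
      · rintro ⟨a1, a2, a3⟩
        have b1 : u < x := (gr_mono J c d).reflect_lt a2
        have b2 : x < v - 1 := (gr_mono J c d).reflect_lt a3
        exact ⟨⟨by omega, by omega⟩, a2.ne', a3.ne⟩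
    rw [this, ← Finset.sum_fiberwise_of_maps_to (g := gr J c d) (t := Ioo (gr J c d u) (gr J c d (v-1)))
      (fun x hx => (Finset.mem_filter.1 hx).2)]
    refine Finset.sum_eq_zero fun w hw => ?_
    rw [← hg w]
    apply Finset.sum_congr _ (fun _ _ => rfl)
    ext x; simp only [mem_filter]
    constructor
    · rintro ⟨⟨a, _⟩, b⟩; exact ⟨a, b⟩
    · rintro ⟨a, b⟩; exact ⟨⟨a, b ▸ hw⟩, b⟩
  have hcard : (B.card : ℝ) ≤ 2 * 2^(J-d) := by
    have : B ⊆ ((range M).filter (fun y => gr J c d y = gr J c d u)) ∪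
        ((range M).filter (fun y => gr J c d y = gr J c d (v-1))) := by
      intro x hx
      simp only [hB, mem_filter, mem_Ico, mem_union, mem_range] at *
      rcases hx.2 with h | h
      · exact Or.inl ⟨by omega, h⟩
      · exact Or.inr ⟨by omega, h⟩
    have h2 := (Finset.card_le_card this).trans (Finset.card_union_le _ _)
    have h3 := card_gr M J c d (gr J c d u)
    have h4 := card_gr M J c d (gr J c d (v-1))
    have : B.card ≤ 2 * 2^(J-d) := by omega
    exact_mod_cast this
  rw [h1]
  calc _ ≤ (B.card : ℝ) * ∑ x ∈ B, (g x)^2 := sq_sum_le_card_mul_sum_sq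
    _ ≤ _ := mul_le_mul hcard (Finset.sum_le_sum_of_subset_of_nonneg (Finset.filter_subset _ _)
        (fun _ _ _ => sq_nonneg _)) (Finset.sum_nonneg fun _ _ => sq_nonneg _) (by positivity)

/-- second shift -/
def c1 (T : ℕ) : ℕ := ∑ i ∈ range T, 4^i

lemma c1_eq (T : ℕ) : 3 * c1 T + 1 = 4^T := by
  induction T with
  | zero => simp [c1]
  | succ T ih => unfold c1 at *; rw [Finset.sum_range_succ, pow_succ]; omega

lemma two_grids (J d T x y : ℕ) (hxy : x ≤ y) (ht : J - d ≤ 2 * T) (h : 3 * (y - x) < 2^(J-d)) :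
    gr J 0 d x = gr J 0 d y ∨ gr J (c1 T) d x = gr J (c1 T) d y := by
  by_contra hcon
  push Not at hcon
  obtain ⟨h1, h2⟩ := hcon
  have h1 := lt_of_le_of_ne (gr_mono J 0 d hxy) h1
  have h2 := lt_of_le_of_ne (gr_mono J (c1 T) d hxy) h2
  have hp : 0 < 2^(J-d) := by positivity
  have hc := c1_eq T
  have h4 : 4^T = 2^(J-d) * 2^(2*T-(J-d)) := by
    rw [← pow_add, show (4:ℕ) = 2^2 by norm_num, ← pow_mul]; congr 1; omega
  have h3 : (2^(2*T-(J-d))) % 3 ≠ 0 := by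
    intro h
    have := (Nat.Prime.dvd_of_dvd_pow Nat.prime_three (Nat.dvd_of_mod_eq_zero h))
    norm_num at this
  unfold gr at h1 h2
  simp only [add_zero] at h1
  generalize 2^(2*T-(J-d)) = Q at *
  generalize c1 T = c at *
  generalize 2^(J-d) = D at *
  rw [h4] at hc
  have a1 := Nat.lt_mul_div_succ x hp
  have a2 := Nat.mul_div_le y D
  have a3 := Nat.lt_mul_div_succ (x+c) hp
  have a4 := Nat.mul_div_le (y+c) D
  generalize x / D = q at *
  generalize y / D = q' at *
  generalize (x+c)/D = r at *
  generalize (y+c)/D = r' at *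
  have a2' : D * (q+1) ≤ y := (Nat.mul_le_mul_left D h1).trans a2
  have a4' : D * (r+1) ≤ y + c := (Nat.mul_le_mul_left D h2).trans a4
  obtain ⟨w, rfl⟩ := Nat.exists_eq_add_of_le hxy
  simp only [Nat.add_sub_cancel_left] at h
  clear a2 a4 h1 h2
  zify at *
  have hz : (3 * ((r:ℤ) - q) - Q) ≠ 0 := by omega
  rcases lt_or_gt_of_ne hz with hz | hz
  · have : (3 * ((r:ℤ) - q) - Q) ≤ -1 := by omega
    nlinarith
  · have : 1 ≤ (3 * ((r:ℤ) - q) - Q) := by omega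
    nlinarith
end QME

namespace QME

/-- averages over integer intervals -/
noncomputable def av (f : ℕ → ℝ) (u v : ℕ) : ℝ := (∑ x ∈ Ico u v, f x) / ((v : ℝ) - u)

/-- martingale differences -/
noncomputable def dl (M J c : ℕ) (f : ℕ → ℝ) (j y : ℕ) : ℝ :=
  cE (range M) (gr J c) (j+1) f y - cE (range M) (gr J c) j f y

lemma dl_class (M J c : ℕ) (f : ℕ → ℝ) (j : ℕ) (w : ℕ) :
    ∑ x ∈ range M with gr J c j x = w, dl M J c f j x = 0 := by
  unfold dl
  rw [Finset.sum_sub_distrib, cE_class_sum, sub_eq_zero]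
  have h := cE_sum (Ω := range M) (π := gr J c) (j+1) f (fun x => if gr J c j x = w then 1 else 0)
    (fun x y h => by simp [gr_nest J c j x y h])
  simpa [Finset.sum_filter] using h

lemma av_decomp (M J c e k u v : ℕ) (f : ℕ → ℝ) (heJ : e ≤ J) (huv : u < v) (hv : v ≤ M)
    (hcl : ∀ x ∈ Ico u v, gr J c e x = gr J c e k) :
    av f u v = cE (range M) (gr J c) e f k + ∑ j ∈ Ico e J, av (dl M J c f j) u v := by
  have hne : (v : ℝ) - u ≠ 0 := by
    have : (u : ℝ) < v := by exact_mod_cast huv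
    linarith
  unfold av
  rw [← Finset.sum_div, Finset.sum_comm]
  have : ∀ x ∈ Ico u v, ∑ j ∈ Ico e J, dl M J c f j x = f x - cE (range M) (gr J c) e f k := by
    intro x hx
    unfold dl
    rw [Finset.sum_Ico_sub (fun j => cE (range M) (gr J c) j f x) heJ,
      cE_top M J c f (by have := (mem_Ico.1 hx).2; omega), cE_congr f (hcl x hx)]
  rw [Finset.sum_congr rfl this, Finset.sum_sub_distrib, Finset.sum_const, nsmul_eq_mul,
    Nat.card_Ico, Nat.cast_sub huv.le]
  field_simp
  ring

lemma cls_sum_le (M J c e k : ℕ) (g : ℕ → ℝ) (hg : ∀ x, 0 ≤ g x) (hk : k < M) :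
    ∑ x ∈ range M with gr J c e x = gr J c e k, g x ≤
      2^(J-e) * cE (range M) (gr J c) e g k := by
  unfold cE
  have hc : 0 < (((range M).filter (fun y => gr J c e y = gr J c e k)).card : ℝ) := by
    have : k ∈ (range M).filter (fun y => gr J c e y = gr J c e k) := by simp [hk]
    exact_mod_cast (Finset.card_pos.2 ⟨k, this⟩)
  have h2 : (((range M).filter (fun y => gr J c e y = gr J c e k)).card : ℝ) ≤ 2^(J-e) := by
    exact_mod_cast card_gr M J c e (gr J c e k)
  rw [← mul_div_assoc, le_div_iff₀ hc, mul_comm]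
  exact mul_le_mul_of_nonneg_right h2 (Finset.sum_nonneg fun _ _ => hg _)

lemma pow_id (J e j s : ℕ) (hJ : J = e + (s + 4)) (h1 : e ≤ j) (h2 : j ≤ J) :
    (2 * 2^(J-j) * 2^(J-e) : ℝ) = 512 * 4^s * (1/2 : ℝ)^(j-e) := by
  obtain ⟨r, rfl⟩ := Nat.exists_eq_add_of_le h1
  obtain ⟨q, hq⟩ := Nat.exists_eq_add_of_le h2
  have e1 : J - (e + r) = q := by omega
  have e2 : J - e = r + q := by omega
  have e3 : s + 4 = r + q := by omega
  rw [e1, e2, Nat.add_sub_cancel_left]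
  have e4 : (4:ℝ)^s * 256 = 2^(r+q) * 2^(r+q) := by
    rw [← e3, ← mul_pow]; norm_num; rw [pow_add]; norm_num
  have e5 : (512 : ℝ) * 4^s = 2 * (2^(r+q) * 2^(r+q)) := by rw [← e4]; ring
  rw [e5, pow_add, one_div, inv_pow]
  field_simp

/-- Single average of a martingale difference. -/
lemma av_dl_sq (M J c e k u v s j : ℕ) (f : ℕ → ℝ) (hJ : J = e + (s + 4)) (huv : u + 2^s ≤ v)
    (hv : v ≤ M) (hk : k < M) (hcl : ∀ x ∈ Ico u v, gr J c e x = gr J c e k)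
    (h1 : e ≤ j) (h2 : j < J) :
    (av (dl M J c f j) u v)^2 ≤ 512 * ((1/2 : ℝ)^(j-e) *
      cE (range M) (gr J c) e (fun y => (dl M J c f j y)^2) k) := by
  have hker := kernel M J c j u v hv _ (dl_class M J c f j)
  have hsub : ∑ x ∈ Ico u v, (dl M J c f j x)^2 ≤
      ∑ x ∈ range M with gr J c e x = gr J c e k, (dl M J c f j x)^2 := by
    refine Finset.sum_le_sum_of_subset_of_nonneg ?_ (fun _ _ _ => sq_nonneg _)
    intro x hx
    simp only [mem_filter, mem_range]
    exact ⟨by have := (mem_Ico.1 hx).2; omega, hcl x hx⟩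
  have h3 := cls_sum_le M J c e k (fun y => (dl M J c f j y)^2) (fun _ => sq_nonneg _) hk
  have hp := pow_id J e j s hJ h1 h2.le
  set X := cE (range M) (gr J c) e (fun y => (dl M J c f j y)^2) k with hX
  have hlen : (2:ℝ)^s ≤ (v:ℝ) - u := by
    have : ((u + 2^s : ℕ) : ℝ) ≤ v := by exact_mod_cast huv
    push_cast at this; linarith
  have h2s : (0:ℝ) < 2^s := by positivity
  unfold av
  rw [div_pow, div_le_iff₀ (by nlinarith)]
  have h5 : (∑ x ∈ Ico u v, dl M J c f j x)^2 ≤ 512 * 4^s * (1/2 : ℝ)^(j-e) * X := by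
    rw [← hp]
    refine hker.trans ?_
    rw [mul_assoc (2 * 2^(J-j) : ℝ)]
    exact mul_le_mul_of_nonneg_left (hsub.trans h3) (by positivity)
  refine h5.trans ?_
  have h6 : (4:ℝ)^s ≤ ((v:ℝ)-u)^2 := by
    have : (4:ℝ)^s = (2^s)^2 := by rw [← pow_mul, mul_comm, pow_mul]; norm_num
    rw [this]; exact pow_le_pow_left₀ h2s.le hlen 2
  have hX0 : 0 ≤ X := cE_nonneg (fun _ => sq_nonneg _) _
  calc _ = (512 * ((1/2 : ℝ)^(j-e) * X)) * 4^s := by ring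
    _ ≤ _ := mul_le_mul_of_nonneg_left h6 (by positivity)

/-- comparison of two averages -/
lemma compare (M J c e k u v u' v' s : ℕ) (f : ℕ → ℝ) (hJ : J = e + (s + 4)) (huv : u + 2^s ≤ v)
    (hv : v ≤ M) (hk : k < M) (hcl : ∀ x ∈ Ico u v, gr J c e x = gr J c e k)
    (huv' : u' + 2^s ≤ v')
    (hv' : v' ≤ M) (hcl' : ∀ x ∈ Ico u' v', gr J c e x = gr J c e k) :
    (av f u v - av f u' v')^2 ≤ 8192 * Dt (range M) (gr J c) J f e k := by
  have h2s : 0 < 2^s := by positivity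
  have h := numP (Finset.univ : Finset Unit) e J (fun _ => av f u v - av f u' v')
    (fun _ j => av (dl M J c f j) u v - av (dl M J c f j) u' v')
    (fun j => cE (range M) (gr J c) e (fun y => (dl M J c f j y)^2) k) 2048
    (fun _ _ => by
      rw [av_decomp M J c e k u v f (by omega) (by omega) hv hcl,
        av_decomp M J c e k u' v' f (by omega) (by omega) hv' hcl', Finset.sum_sub_distrib]
      ring)
    (fun j hj => by
      obtain ⟨h1, h2⟩ := mem_Ico.1 hj
      have a1 := av_dl_sq M J c e k u v s j f hJ huv hv hk hcl h1 h2
      have a2 := av_dl_sq M J c e k u' v' s j f hJ huv' hv' hk hcl' h1 h2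
      simp only [Finset.univ_unique, Finset.sum_singleton]
      nlinarith [sq_nonneg (av (dl M J c f j) u v + av (dl M J c f j) u' v')])
  simp only [Finset.univ_unique, Finset.sum_singleton] at h
  refine h.trans (le_of_eq ?_)
  unfold Dt dl
  norm_num

lemma av_step (g : ℕ → ℝ) (k m n : ℕ) (hmn : m ≤ n) (S : ℝ) (hS : 0 < S) (h1 : S ≤ (m:ℝ) + 1) :
    (av g k (k+m+1) - av g k (k+n+1))^2 ≤
      2 * ((∑ x ∈ Ico k (k+m+1), g x)^2 * ((n:ℝ)-m)^2 / S^4 +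
        (∑ x ∈ Ico (k+m+1) (k+n+1), g x)^2 / S^2) := by
  have hmn' : (m:ℝ) ≤ n := by exact_mod_cast hmn
  have hs := Finset.sum_Ico_consecutive g (show k ≤ k+m+1 by omega) (show k+m+1 ≤ k+n+1 by omega)
  unfold av
  rw [← hs]
  set A := ∑ x ∈ Ico k (k+m+1), g x
  set G := ∑ x ∈ Ico (k+m+1) (k+n+1), g x
  push_cast
  have hm0 : (0:ℝ) < m + 1 := by positivity
  have hn0 : (0:ℝ) < n + 1 := by positivity
  have e1 : A / ((k:ℝ)+m+1-k) - (A+G)/((k:ℝ)+n+1-k) =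
      A * ((n:ℝ)-m) / (((m:ℝ)+1)*((n:ℝ)+1)) - G / ((n:ℝ)+1) := by
    have : (k:ℝ)+m+1-k = m+1 := by ring
    rw [this]
    have : (k:ℝ)+n+1-k = n+1 := by ring
    rw [this]; field_simp; ring
  rw [e1]
  have e2 : (A * ((n:ℝ)-m) / (((m:ℝ)+1)*((n:ℝ)+1)))^2 ≤ A^2 * ((n:ℝ)-m)^2 / S^4 := by
    rw [div_pow, mul_pow]
    apply div_le_div_of_nonneg_left (by positivity) (by positivity)
    have : S * S ≤ ((m:ℝ)+1)*((n:ℝ)+1) := mul_le_mul h1 (by linarith) hS.le hm0.le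
    calc S^4 = (S*S)^2 := by ring
      _ ≤ _ := pow_le_pow_left₀ (by positivity) this 2
  have e3 : (G / ((n:ℝ)+1))^2 ≤ G^2 / S^2 := by
    rw [div_pow]
    apply div_le_div_of_nonneg_left (by positivity) (by positivity)
    exact pow_le_pow_left₀ hS.le (by linarith) 2
  nlinarith [sq_nonneg (A * ((n:ℝ)-m) / (((m:ℝ)+1)*((n:ℝ)+1)) + G / ((n:ℝ)+1))]

lemma disj_sum (I : Finset ℕ) (n : ℕ → ℕ) (hn : StrictMono n) (k : ℕ) (R : Finset ℕ) (φ : ℕ → ℝ)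
    (hφ : ∀ x, 0 ≤ φ x) (hR : ∀ i ∈ I, Ico (k + n i + 1) (k + n (i+1) + 1) ⊆ R) :
    ∑ i ∈ I, ∑ x ∈ Ico (k + n i + 1) (k + n (i+1) + 1), φ x ≤ ∑ x ∈ R, φ x := by
  rw [← Finset.sum_biUnion]
  · exact Finset.sum_le_sum_of_subset_of_nonneg (Finset.biUnion_subset.2 hR) (fun _ _ _ => hφ _)
  · intro i _ j _ hij
    rw [Function.onFun, Finset.disjoint_left]
    intro x hx hx'
    simp only [mem_Ico] at hx hx'
    rcases Nat.lt_or_gt_of_ne hij with h | h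
    · have := hn.monotone (show i+1 ≤ j by omega); omega
    · have := hn.monotone (show j+1 ≤ i by omega); omega

/-- short jumps in one dyadic block -/
lemma short (M J c e k s : ℕ) (f : ℕ → ℝ) (hJ : J = e + (s + 4)) (n : ℕ → ℕ) (hn : StrictMono n)
    (I : Finset ℕ) (hk : k < M)
    (hI1 : ∀ i ∈ I, 2^s ≤ n i) (hI2 : ∀ i ∈ I, n (i+1) < 2^(s+1))
    (hI3 : ∀ i ∈ I, k + n (i+1) < M)
    (hcl : ∀ x ∈ Ico k (k + 2^(s+1)), gr J c e x = gr J c e k) :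
    ∑ i ∈ I, (av f k (k + n i + 1) - av f k (k + n (i+1) + 1))^2 ≤
      8192 * Dt (range M) (gr J c) J f e k := by
  have hlt : ∀ i, n i < n (i+1) := fun i => hn (Nat.lt_succ_self i)
  have hS0 : (0:ℝ) < 2^s := by positivity
  have h := numP I e J (fun i => av f k (k + n i + 1) - av f k (k + n (i+1) + 1))
    (fun i j => av (dl M J c f j) k (k + n i + 1) - av (dl M J c f j) k (k + n (i+1) + 1))
    (fun j => cE (range M) (gr J c) e (fun y => (dl M J c f j y)^2) k) 2048
    (fun i hi => by
      have := hlt i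
      have := hI2 i hi
      have := hI3 i hi
      rw [av_decomp M J c e k k (k + n i + 1) f (by omega) (by omega) (by omega)
          (fun x hx => hcl x (by simp only [mem_Ico] at *; omega)),
        av_decomp M J c e k k (k + n (i+1) + 1) f (by omega) (by omega) (by omega)
          (fun x hx => hcl x (by simp only [mem_Ico] at *; omega)), Finset.sum_sub_distrib]
      ring)
    (fun j hj => by
      obtain ⟨h1, h2⟩ := mem_Ico.1 hj
      set g := dl M J c f j with hg
      set R := (range M).filter (fun x => gr J c e x = gr J c e k) with hR
      set Q := ∑ x ∈ R, (g x)^2 with hQ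
      have hQ0 : 0 ≤ Q := Finset.sum_nonneg fun _ _ => sq_nonneg _
      have hQ1 : Q ≤ 2^(J-e) * cE (range M) (gr J c) e (fun y => (g y)^2) k :=
        cls_sum_le M J c e k (fun y => (g y)^2) (fun _ => sq_nonneg _) hk
      have hsubR : ∀ i ∈ I, Ico (k + n i + 1) (k + n (i+1) + 1) ⊆ R := by
        intro i hi x hx
        have := hI2 i hi
        have := hI3 i hi
        simp only [hR, mem_filter, mem_range, mem_Ico] at *
        exact ⟨by omega, hcl x (by omega)⟩
      have hsubR' : ∀ i ∈ I, Ico k (k + n i + 1) ⊆ R := by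
        intro i hi x hx
        have := hI2 i hi
        have := hI3 i hi
        have := hlt i
        simp only [hR, mem_filter, mem_range, mem_Ico] at *
        exact ⟨by omega, hcl x (by omega)⟩
      set τ : ℝ := 2 * 2^(J-j) with hτ
      have hτ0 : 0 < τ := by positivity
      have d1 := disj_sum I n hn k R (fun x => (g x)^2) (fun _ => sq_nonneg _) hsubR
      have d2 : ∑ i ∈ I, ((n (i+1) : ℝ) - n i) ≤ 2^s := by
        have := disj_sum I n hn k (Ico (k + 2^s) (k + 2^(s+1))) (fun _ => 1) (fun _ => by norm_num)
          (fun i hi x hx => by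
            have := hI1 i hi
            have := hI2 i hi
            simp only [mem_Ico] at *; omega)
        simp only [sum_const, Nat.card_Ico, nsmul_eq_mul, mul_one] at this
        have e : (((k + 2^(s+1)) - (k + 2^s) : ℕ) : ℝ) = 2^s := by
          have : (k + 2^(s+1)) - (k + 2^s) = 2^s := by rw [pow_succ]; omega
          rw [this]; push_cast; rfl
        rw [e] at this
        refine le_trans (le_of_eq (Finset.sum_congr rfl fun i _ => ?_)) this
        have := hlt i
        have e2 : k + n (i+1) + 1 - (k + n i + 1) = n (i+1) - n i := by omega
        rw [e2, Nat.cast_sub this.le]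
      have step : ∀ i ∈ I, (av g k (k + n i + 1) - av g k (k + n (i+1) + 1))^2 ≤
          2 * (τ * Q / (2^s)^3 * ((n (i+1) : ℝ) - n i) +
            τ / (2^s)^2 * ∑ x ∈ Ico (k + n i + 1) (k + n (i+1) + 1), (g x)^2) := by
        intro i hi
        have q1 := hI1 i hi
        have q2 := hI2 i hi
        have q3 := hI3 i hi
        have q4 := hlt i
        have q5 : (2:ℝ)^s ≤ (n i : ℝ) + 1 := by
          have : ((2^s : ℕ) : ℝ) ≤ n i := by exact_mod_cast q1
          push_cast at this; linarith
        refine (av_step g k (n i) (n (i+1)) q4.le (2^s) hS0 q5).trans ?_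
        refine mul_le_mul_of_nonneg_left (_root_.add_le_add ?_ ?_) (by norm_num)
        · have k1 := kernel M J c j k (k + n i + 1) (by omega) g (dl_class M J c f j)
          have k2 : (∑ x ∈ Ico k (k + n i + 1), g x)^2 ≤ τ * Q :=
            k1.trans (mul_le_mul_of_nonneg_left (Finset.sum_le_sum_of_subset_of_nonneg
              (hsubR' i hi) (fun _ _ _ => sq_nonneg _)) hτ0.le)
          have k3 : (0:ℝ) ≤ (n (i+1) : ℝ) - n i := by
            have : (n i : ℝ) < n (i+1) := by exact_mod_cast q4
            linarith
          have k4 : (n (i+1) : ℝ) - n i ≤ 2^s := by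
            have : n (i+1) ≤ n i + 2^s := by rw [pow_succ] at q2; omega
            have : ((n (i+1) : ℕ) : ℝ) ≤ ((n i + 2^s : ℕ) : ℝ) := by exact_mod_cast this
            push_cast at this; linarith
          rw [div_le_iff₀ (by positivity)]
          calc _ ≤ (τ * Q) * (((n (i+1) : ℝ) - n i) * 2^s) := by
                refine mul_le_mul k2 ?_ (sq_nonneg _) (by positivity)
                rw [sq]; exact mul_le_mul_of_nonneg_left k4 k3
            _ = _ := by field_simp
        · rw [div_mul_eq_mul_div]
          gcongr
          exact kernel M J c j _ (k + n (i+1) + 1) (by omega) g (dl_class M J c f j)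
      refine (Finset.sum_le_sum step).trans ?_
      rw [← Finset.mul_sum, Finset.sum_add_distrib, ← Finset.mul_sum, ← Finset.mul_sum]
      have hp := pow_id J e j s hJ h1 h2.le
      have p1 : τ * Q / (2^s)^3 * ∑ i ∈ I, ((n (i+1) : ℝ) - n i) ≤ τ * Q / (2^s)^2 := by
        refine (mul_le_mul_of_nonneg_left d2 (by positivity)).trans (le_of_eq ?_)
        field_simp
      have p2 : τ / (2^s)^2 * ∑ i ∈ I, ∑ x ∈ Ico (k + n i + 1) (k + n (i+1) + 1), (g x)^2
          ≤ τ * Q / (2^s)^2 := by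
        rw [show τ * Q / (2^s)^2 = τ / (2^s)^2 * Q by ring]
        exact mul_le_mul_of_nonneg_left d1 (by positivity)
      have p3 : τ * Q / (2^s)^2 ≤ 512 * ((1/2 : ℝ)^(j-e) *
          cE (range M) (gr J c) e (fun y => (g y)^2) k) := by
        rw [div_le_iff₀ (by positivity)]
        have e4 : ((2:ℝ)^s)^2 = 4^s := by rw [← pow_mul, mul_comm, pow_mul]; norm_num
        rw [e4]
        refine (mul_le_mul_of_nonneg_left hQ1 hτ0.le).trans (le_of_eq ?_)
        rw [← mul_assoc, hp]; ring
      linarith)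
  refine h.trans (le_of_eq ?_)
  unfold Dt dl
  norm_num

end QME

namespace QME

/-- sum of the two remainders -/
noncomputable def D2 (M J : ℕ) (f : ℕ → ℝ) (e k : ℕ) : ℝ :=
  Dt (range M) (gr J 0) J f e k + Dt (range M) (gr J (c1 J)) J f e k

lemma D2_nonneg (M J : ℕ) (f : ℕ → ℝ) (e k : ℕ) : 0 ≤ D2 M J f e k :=
  add_nonneg (Dt_nonneg _ _ _ _ _ _) (Dt_nonneg _ _ _ _ _ _)

lemma same_class {J c e x y k : ℕ} (h : gr J c e x = gr J c e y) (hk : k ∈ Ico x (y+1)) :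
    ∀ z ∈ Ico x (y+1), gr J c e z = gr J c e k := by
  have key : ∀ z ∈ Ico x (y+1), gr J c e z = gr J c e x := by
    intro z hz
    have hz := mem_Ico.1 hz
    have a := gr_mono J c e hz.1
    have b := gr_mono J c e (show z ≤ y by omega)
    omega
  intro z hz
  rw [key z hz, key k hk]

lemma log_bounds {n : ℕ} (hn : 0 < n) : 2^(Nat.log 2 n) ≤ n ∧ n < 2^(Nat.log 2 n + 1) :=
  ⟨Nat.pow_log_le_self 2 hn.ne', Nat.lt_pow_succ_log_self (by norm_num) n⟩

lemma long1 (M J e k n : ℕ) (f : ℕ → ℝ) (hn : 0 < n) (hk : k + n < M)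
    (hJ : J = e + (Nat.log 2 n + 4)) :
    (av f k (k+n+1) - cE (range M) (gr J 0) (J - Nat.log 2 n) f k)^2 ≤ 8192 * D2 M J f e k := by
  obtain ⟨hl1, hl2⟩ := log_bounds hn
  set s := Nat.log 2 n with hs
  have h2s : 0 < 2^s := by positivity
  have e0 : J - (J - s) = s := by omega
  have e1 : J - e = s + 4 := by omega
  rw [pow_succ] at hl2
  have hdm := Nat.div_add_mod k (2^s)
  have hml := Nat.mod_lt k h2s
  set q := k / 2^s with hq
  have hav : cE (range M) (gr J 0) (J - s) f k = av f (2^s*q) (2^s*q + 2^s) := by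
    unfold cE av
    have : (range M).filter (fun y => gr J 0 (J-s) y = gr J 0 (J-s) k) = Ico (2^s*q) (2^s*q+2^s) := by
      ext y
      simp only [mem_filter, mem_range, mem_Ico, gr, e0, add_zero]
      rw [← hq]
      constructor
      · rintro ⟨_, h⟩
        have a := Nat.div_add_mod y (2^s)
        have b := Nat.mod_lt y h2s
        rw [h] at a
        omega
      · rintro ⟨h1, h2⟩
        refine ⟨by omega, ?_⟩
        apply Nat.div_eq_of_lt_le
        · rw [mul_comm]; exact h1
        · rw [mul_comm, Nat.mul_add]; omega
    rw [this, Nat.card_Ico]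
    congr 1
    push_cast [Nat.add_sub_cancel_left]; ring
  rw [hav]
  have key : ∀ c, gr J c e (2^s*q) = gr J c e (k+n) →
      (av f k (k+n+1) - av f (2^s*q) (2^s*q + 2^s))^2 ≤ 8192 * Dt (range M) (gr J c) J f e k := by
    intro c hc
    have hcl := same_class hc (k := k) (by simp only [mem_Ico]; omega)
    apply compare M J c e k k (k+n+1) _ _ s f hJ (by omega) (by omega) (by omega)
      (fun x hx => hcl x (by simp only [mem_Ico] at *; omega)) le_rfl (by omega)
      (fun x hx => hcl x (by simp only [mem_Ico] at *; omega))
  have hg := two_grids J e J (2^s*q) (k+n) (by omega) (by omega)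
    (by rw [e1, pow_add]; omega)
  have n1 := Dt_nonneg (range M) (gr J 0) J f e k
  have n2 := Dt_nonneg (range M) (gr J (c1 J)) J f e k
  unfold D2
  rcases hg with h | h
  · have := key _ h; linarith
  · have := key _ h; linarith

lemma short2 (M J e k s : ℕ) (f : ℕ → ℝ) (hJ : J = e + (s + 4)) (n : ℕ → ℕ) (hn : StrictMono n)
    (I : Finset ℕ) (hk : k < M)
    (hI1 : ∀ i ∈ I, 2^s ≤ n i) (hI2 : ∀ i ∈ I, n (i+1) < 2^(s+1))
    (hI3 : ∀ i ∈ I, k + n (i+1) < M) :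
    ∑ i ∈ I, (av f k (k + n i + 1) - av f k (k + n (i+1) + 1))^2 ≤ 8192 * D2 M J f e k := by
  have h2s : 0 < 2^s := by positivity
  have e1 : J - e = s + 4 := by omega
  have key : ∀ c, gr J c e k = gr J c e (k + 2^(s+1) - 1) →
      ∑ i ∈ I, (av f k (k + n i + 1) - av f k (k + n (i+1) + 1))^2
        ≤ 8192 * Dt (range M) (gr J c) J f e k := by
    intro c hc
    have hcl := same_class hc (k := k) (by simp only [mem_Ico]; omega)
    refine short M J c e k s f hJ n hn I hk hI1 hI2 hI3 (fun x hx => hcl x ?_)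
    simp only [mem_Ico] at *; omega
  have hg := two_grids J e J k (k + 2^(s+1) - 1) (by rw [pow_succ]; omega) (by omega)
    (by
      have a : 2^(s+4) = 2^s*16 := by rw [pow_add]; norm_num
      have b : 2^(s+1) = 2^s*2 := pow_succ _ _
      rw [e1]; omega)
  have n1 := Dt_nonneg (range M) (gr J 0) J f e k
  have n2 := Dt_nonneg (range M) (gr J (c1 J)) J f e k
  unfold D2
  rcases hg with h | h
  · have := key _ h; linarith
  · have := key _ h; linarith

/-- pointwise domination of the square function -/
lemma pointwise (M N k S : ℕ) (f : ℕ → ℝ) (n : ℕ → ℕ) (hn : StrictMono n) (hpos : ∀ i, 0 < n i)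
    (hk : k + n N < M) (hS : ∀ i ≤ N, Nat.log 2 (n i) < S) :
    ∑ i ∈ range N, (av f k (k + n i + 1) - av f k (k + n (i+1) + 1))^2 ≤
      57344 * ∑ e ∈ range (S+4), D2 M (S+4) f e k +
      3 * ∑ i ∈ range N, (cE (range M) (gr (S+4) 0) (S+4 - Nat.log 2 (n i)) f k -
        cE (range M) (gr (S+4) 0) (S+4 - Nat.log 2 (n (i+1))) f k)^2 := by
  set s : ℕ → ℕ := fun i => Nat.log 2 (n i) with hs
  have hsm : Monotone s := fun i j hij => Nat.log_mono_right (hn.monotone hij)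
  set J := S + 4 with hJ
  set U : ℕ → ℝ := fun i => av f k (k + n i + 1) with hU
  set V : ℕ → ℝ := fun i => cE (range M) (gr J 0) (J - s i) f k with hV
  have hle : ∀ i ≤ N, k + n i < M := fun i hi => by have := hn.monotone hi; omega
  -- sum over scales
  have hT : ∀ A : Finset ℕ, A ⊆ range S → ∑ t ∈ A, D2 M J f (S - t) k ≤
      ∑ e ∈ range J, D2 M J f e k := by
    intro A hA
    have : ∑ t ∈ A, D2 M J f (S - t) k = ∑ e ∈ A.image (fun t => S - t), D2 M J f e k := by
      rw [Finset.sum_image]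
      intro a ha b hb hab
      have := mem_range.1 (hA ha)
      have := mem_range.1 (hA hb)
      simp only at hab
      omega
    rw [this]
    refine Finset.sum_le_sum_of_subset_of_nonneg ?_ (fun _ _ _ => D2_nonneg _ _ _ _ _)
    intro e he
    obtain ⟨t, _, rfl⟩ := Finset.mem_image.1 he
    rw [mem_range]; omega
  set Z := ∑ e ∈ range J, D2 M J f e k with hZ
  -- long
  have hlong : ∀ i ≤ N, (U i - V i)^2 ≤ 8192 * D2 M J f (S - s i) k := by
    intro i hi
    have := hS i hi
    exact long1 M J (S - s i) k (n i) f (hpos i) (hle i hi) (by simp only [hs]; omega)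
  have hsplit := Finset.sum_filter_add_sum_filter_not (range N) (fun i => s i = s (i+1))
    (fun i => (U i - U (i+1))^2)
  have hshort : ∑ i ∈ range N with s i = s (i+1), (U i - U (i+1))^2 ≤ 8192 * Z := by
    rw [← Finset.sum_fiberwise_of_maps_to (g := s) (t := range S) (fun i hi => by
      have := mem_range.1 (mem_filter.1 hi).1
      exact mem_range.2 (hS i (by omega)))]
    refine (Finset.sum_le_sum (g := fun t => 8192 * D2 M J f (S - t) k) fun t ht => ?_).trans ?_
    · have ht := mem_range.1 ht
      refine short2 M J (S - t) k t f (by omega) n hn _ (by have := hle 0 (by omega); omega) ?_ ?_ ?_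
      · intro i hi
        simp only [mem_filter, mem_range] at hi
        rw [← hi.2]; exact (log_bounds (hpos i)).1
      · intro i hi
        simp only [mem_filter, mem_range] at hi
        rw [← hi.2, hi.1.2]; exact (log_bounds (hpos (i+1))).2
      · intro i hi
        simp only [mem_filter, mem_range] at hi
        exact hle _ (by omega)
    · rw [← Finset.mul_sum]
      exact mul_le_mul_of_nonneg_left (hT _ (Finset.Subset.refl _)) (by norm_num)
  set A := (range N).filter (fun i => ¬ s i = s (i+1)) with hA
  have hl1 : ∑ i ∈ A, (U i - V i)^2 ≤ 8192 * Z := by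
    refine (Finset.sum_le_sum (g := fun i => 8192 * D2 M J f (S - s i) k) fun i hi => ?_).trans ?_
    · simp only [hA, mem_filter, mem_range] at hi
      exact hlong i (by omega)
    · rw [← Finset.mul_sum]
      refine mul_le_mul_of_nonneg_left ?_ (by norm_num)
      rw [← Finset.sum_image (f := fun t => D2 M J f (S - t) k) (g := s)]
      · refine hT _ fun t ht => ?_
        obtain ⟨i, hi, rfl⟩ := mem_image.1 ht
        simp only [hA, mem_filter, mem_range] at hi
        exact mem_range.2 (hS i (by omega))
      · intro i hi j hj hij
        simp only [hA, coe_filter, mem_range, Set.mem_ofPred_eq] at hi hj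
        by_contra hne
        rcases Nat.lt_or_gt_of_ne hne with h | h
        · have a := hsm (show i+1 ≤ j by omega)
          have b := hsm (show i ≤ i+1 by omega)
          omega
        · have a := hsm (show j+1 ≤ i by omega)
          have b := hsm (show j ≤ j+1 by omega)
          omega
  have hl2 : ∑ i ∈ A, (U (i+1) - V (i+1))^2 ≤ 8192 * Z := by
    refine (Finset.sum_le_sum (g := fun i => 8192 * D2 M J f (S - s (i+1)) k)
      fun i hi => ?_).trans ?_
    · simp only [hA, mem_filter, mem_range] at hi
      exact hlong (i+1) (by omega)
    · rw [← Finset.mul_sum]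
      refine mul_le_mul_of_nonneg_left ?_ (by norm_num)
      rw [← Finset.sum_image (f := fun t => D2 M J f (S - t) k) (g := fun i => s (i+1))]
      · refine hT _ fun t ht => ?_
        obtain ⟨i, hi, rfl⟩ := mem_image.1 ht
        simp only [hA, mem_filter, mem_range] at hi
        exact mem_range.2 (hS (i+1) (by omega))
      · intro i hi j hj hij
        simp only [hA, coe_filter, mem_range, Set.mem_ofPred_eq] at hi hj hij
        by_contra hne
        rcases Nat.lt_or_gt_of_ne hne with h | h
        · have a := hsm (show i+1 ≤ j by omega)
          have b := hsm (show j ≤ j+1 by omega)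
          omega
        · have a := hsm (show j+1 ≤ i by omega)
          have b := hsm (show i ≤ i+1 by omega)
          omega
  have hl3 : ∑ i ∈ A, (V i - V (i+1))^2 ≤ ∑ i ∈ range N, (V i - V (i+1))^2 :=
    Finset.sum_le_sum_of_subset_of_nonneg (Finset.filter_subset _ _) (fun _ _ _ => sq_nonneg _)
  have hl : ∑ i ∈ A, (U i - U (i+1))^2 ≤ 3 * ∑ i ∈ A, (U i - V i)^2 +
      3 * ∑ i ∈ A, (V i - V (i+1))^2 + 3 * ∑ i ∈ A, (U (i+1) - V (i+1))^2 := by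
    rw [Finset.mul_sum, Finset.mul_sum, Finset.mul_sum, ← Finset.sum_add_distrib,
      ← Finset.sum_add_distrib]
    refine Finset.sum_le_sum fun i _ => ?_
    nlinarith [sq_nonneg ((U i - V i) - (V i - V (i+1))),
      sq_nonneg ((U i - V i) + (U (i+1) - V (i+1))),
      sq_nonneg ((V i - V (i+1)) + (U (i+1) - V (i+1)))]
  rw [← hsplit]
  linarith

end QME

namespace QME

/-- square of the one-dimensional square function -/
noncomputable def Sq (N : ℕ) (n : ℕ → ℕ) (a : ℕ → ℝ) (k : ℕ) : ℝ :=
  ∑ i ∈ range N, (av a k (k + n i + 1) - av a k (k + n (i+1) + 1))^2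

lemma Sq_nonneg (N : ℕ) (n : ℕ → ℕ) (a : ℕ → ℝ) (k : ℕ) : 0 ≤ Sq N n a k :=
  Finset.sum_nonneg fun _ _ => sq_nonneg _

lemma weighted (M N L : ℕ) (n : ℕ → ℕ) (hn : StrictMono n) (hpos : ∀ i, 0 < n i)
    (hL : L + n N ≤ M) (a h : ℕ → ℝ) (hh : ∀ x, 0 ≤ h x) (hhL : ∀ k, L ≤ k → h k = 0) :
    ∃ J, ∑ k ∈ range M, h k * Sq N n a k ≤ 172100 * ∑ k ∈ range M,
      (mV (range M) (gr J 0) h J k * (mV (range M) (gr J 0) (fun y => |a y|) J k)^2 +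
       mV (range M) (gr J (c1 J)) h J k * (mV (range M) (gr J 0) (fun y => |a y|) J k)^2) := by
  set S := Nat.log 2 (n N) + 1 with hS
  have hS' : ∀ i ≤ N, Nat.log 2 (n i) < S := fun i hi => by
    have := Nat.log_mono_right (b := 2) (hn.monotone hi); omega
  set J := S + 4 with hJ
  refine ⟨J, ?_⟩
  set F : ℕ → ℝ := fun k => mV (range M) (gr J 0) (fun y => |a y|) J k with hF
  set s : ℕ → ℕ := fun i => J - Nat.log 2 (n i) with hs
  have hsA : Antitone s := fun i j hij => by
    have := Nat.log_mono_right (b := 2) (hn.monotone hij); simp only [hs]; omega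
  have hF0 : ∀ k, 0 ≤ F k := fun k => mV_nonneg (fun _ => abs_nonneg _) _ _
  have haF : ∀ k ∈ range M, (a k)^2 ≤ (F k)^2 := by
    intro k hk
    have h1 := le_mV_self (Ω := range M) (π := gr J 0) (fun y => |a y|) J k
    rw [cE_top M J 0 _ (mem_range.1 hk)] at h1
    exact sq_le_sq' (by have := neg_abs_le (a k); linarith) (by have := le_abs_self (a k); linarith)
  -- pointwise
  have hpt : ∀ k ∈ range M, h k * Sq N n a k ≤
      57344 * ∑ e ∈ range J, (h k * Dt (range M) (gr J 0) J a e k) +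
      57344 * ∑ e ∈ range J, (h k * Dt (range M) (gr J (c1 J)) J a e k) +
      3 * ∑ i ∈ range N, h k * (cE (range M) (gr J 0) (s i) a k -
        cE (range M) (gr J 0) (s (i+1)) a k)^2 := by
    intro k hk
    by_cases hkL : k < L
    · have := mul_le_mul_of_nonneg_left (pointwise M N k S a n hn hpos (by omega) hS') (hh k)
      refine this.trans (le_of_eq ?_)
      simp only [D2, Finset.sum_add_distrib, ← Finset.mul_sum]
      ring
    · rw [hhL k (by omega)]; simp
  have hsum := Finset.sum_le_sum hpt
  rw [Finset.sum_add_distrib, Finset.sum_add_distrib, ← Finset.mul_sum, ← Finset.mul_sum,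
    ← Finset.mul_sum, Finset.sum_comm (s := range M) (t := range J),
    Finset.sum_comm (s := range M) (t := range J),
    Finset.sum_comm (s := range M) (t := range N)] at hsum
  have g : ∀ c, ∑ e ∈ range J, ∑ x ∈ range M, h x * Dt (range M) (gr J c) J a e x ≤
      3 * ∑ x ∈ range M, mV (range M) (gr J c) h J x * (F x)^2 := by
    intro c
    refine (M3 (gr_nest J c) a hh J).trans ?_
    refine mul_le_mul_of_nonneg_left (Finset.sum_le_sum fun x hx => ?_) (by norm_num)
    rw [cE_top M J c _ (mem_range.1 hx)]
    exact mul_le_mul_of_nonneg_left (haF x hx) (mV_nonneg hh _ _)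
  have g0 := g 0
  have g1 := g (c1 J)
  have l : ∑ i ∈ range N, ∑ x ∈ range M, h x * (cE (range M) (gr J 0) (s i) a x -
        cE (range M) (gr J 0) (s (i+1)) a x)^2 ≤
      5 * ∑ x ∈ range M, mV (range M) (gr J 0) h J x * (F x)^2 := by
    have m2 := M2 (Ω := range M) (gr_nest J 0) a (h := h) J s hsA (fun i => Nat.sub_le _ _) N
    have h1 : ∑ i ∈ range N, ∑ x ∈ range M, h x * (cE (range M) (gr J 0) (s i) a x -
        cE (range M) (gr J 0) (s (i+1)) a x)^2 ≤
        ∑ i ∈ range N, ∑ x ∈ range M, mV (range M) (gr J 0) h (s i) x *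
          (cE (range M) (gr J 0) (s i) a x - cE (range M) (gr J 0) (s (i+1)) a x)^2 := by
      refine Finset.sum_le_sum fun i _ => ?_
      rw [← cE_sum (s i) h (fun x => (cE (range M) (gr J 0) (s i) a x -
        cE (range M) (gr J 0) (s (i+1)) a x)^2)]
      · exact Finset.sum_le_sum fun x _ => mul_le_mul_of_nonneg_right (le_mV_self _ _ _) (sq_nonneg _)
      · intro x y hxy
        rw [cE_congr a hxy, cE_congr a (nest_le (gr_nest J 0) (hsA (Nat.le_succ i)) hxy)]
    have h2 : 0 ≤ ∑ x ∈ range M, mV (range M) (gr J 0) h (s N) x *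
        ((cE (range M) (gr J 0) (s N) a x)^2 +
          4 * (mV (range M) (gr J 0) (fun y => |a y|) J x)^2) :=
      Finset.sum_nonneg fun x _ => mul_nonneg (mV_nonneg hh _ _) (by positivity)
    have h3 : ∑ x ∈ range M, mV (range M) (gr J 0) h (s 0) x *
        ((cE (range M) (gr J 0) (s 0) a x)^2 +
          4 * (mV (range M) (gr J 0) (fun y => |a y|) J x)^2) ≤
        5 * ∑ x ∈ range M, mV (range M) (gr J 0) h J x * (F x)^2 := by
      rw [Finset.mul_sum]
      refine Finset.sum_le_sum fun x _ => ?_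
      have a1 : mV (range M) (gr J 0) h (s 0) x ≤ mV (range M) (gr J 0) h J x :=
        mV_mono h x (Nat.sub_le _ _)
      have a2 : (cE (range M) (gr J 0) (s 0) a x)^2 ≤ (F x)^2 := by
        have b1 := abs_cE_le (Ω := range M) (π := gr J 0) (s 0) a x
        have b2 := le_mV (Ω := range M) (π := gr J 0) (fun y => |a y|)
          (show s 0 ≤ J from Nat.sub_le _ _) x
        rw [← sq_abs]
        exact pow_le_pow_left₀ (abs_nonneg _) (b1.trans b2) 2
      have a3 := mV_nonneg (Ω := range M) (π := gr J 0) hh J x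
      calc _ ≤ mV (range M) (gr J 0) h J x * ((F x)^2 + 4 * (F x)^2) := by
            apply mul_le_mul a1 _ (by positivity) a3
            simp only [hF] at a2 ⊢; linarith
        _ = _ := by ring
    linarith
  have p0 : 0 ≤ ∑ x ∈ range M, mV (range M) (gr J 0) h J x * (F x)^2 :=
    Finset.sum_nonneg fun x _ => mul_nonneg (mV_nonneg hh _ _) (by positivity)
  have p1 : 0 ≤ ∑ x ∈ range M, mV (range M) (gr J (c1 J)) h J x * (F x)^2 :=
    Finset.sum_nonneg fun x _ => mul_nonneg (mV_nonneg hh _ _) (by positivity)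
  rw [Finset.sum_add_distrib]
  linarith

lemma mV_le_one (Ω : Finset ℕ) (π : ℕ → ℕ → ℕ) (h : ℕ → ℝ) (h1 : ∀ x, h x ≤ 1) (D x : ℕ) :
    mV Ω π h D x ≤ 1 := by
  have hc : ∀ d, cE Ω π d h x ≤ 1 := by
    intro d
    unfold cE
    apply div_le_one_of_le₀ _ (by positivity)
    refine (Finset.sum_le_sum fun y _ => h1 y).trans ?_
    simp
  induction D with
  | zero => exact hc 0
  | succ D ih => exact max_le ih (hc _)

lemma hold {Ω : Finset ℕ} {π π' : ℕ → ℕ → ℕ}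
    (hπ : ∀ d x y, π (d+1) x = π (d+1) y → π d x = π d y)
    (hπ' : ∀ d x y, π' (d+1) x = π' (d+1) y → π' d x = π' d y)
    {p : ℝ} (hp : 2 < p) (J : ℕ) (a h : ℕ → ℝ) (hh : ∀ x, 0 ≤ h x) :
    ∑ x ∈ Ω, mV Ω π' h J x * (mV Ω π (fun y => |a y|) J x)^2 ≤
      (p/2) * (p/(p-1))^2 * ((∑ x ∈ Ω, (h x)^(p/(p-2)))^(1-2/p) * (∑ x ∈ Ω, |a x|^p)^(2/p)) := by
  have hp2 : 0 < p - 2 := by linarith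
  have hp1 : 0 < p - 1 := by linarith
  have hp0 : 0 < p := by linarith
  set r := p/(p-2) with hr
  have hr1 : 1 < r := by rw [hr, lt_div_iff₀ hp2]; linarith
  have hconj : r.HolderConjugate (p/2) := by
    rw [Real.holderConjugate_iff]
    exact ⟨hr1, by rw [hr]; field_simp; ring⟩
  have H := Real.inner_le_Lp_mul_Lq_of_nonneg Ω hconj (f := fun x => mV Ω π' h J x)
    (g := fun x => (mV Ω π (fun y => |a y|) J x)^2) (fun x _ => mV_nonneg hh _ _)
    (fun x _ => sq_nonneg _)
  have e : ∀ x, ((mV Ω π (fun y => |a y|) J x)^2)^(p/2) = (mV Ω π (fun y => |a y|) J x)^p := by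
    intro x
    rw [← Real.rpow_natCast, ← Real.rpow_mul (mV_nonneg (fun _ => abs_nonneg _) _ _)]
    congr 1; push_cast; ring
  simp only [e] at H
  have d1 := doob (Ω := Ω) hπ' hh hr1 J
  have d2 := doob (Ω := Ω) hπ (h := fun y => |a y|) (fun _ => abs_nonneg _)
    (show 1 < p by linarith) J
  have c1 : 1/r = 1 - 2/p := by rw [hr]; field_simp
  have c2 : 1/(p/2) = 2/p := by field_simp
  have c3 : r/(r-1) = p/2 := by
    have : r - 1 = 2/(p-2) := by rw [hr]; field_simp; ring
    rw [this, hr]; field_simp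
  rw [c3] at d1
  rw [c1, c2] at H
  have A0 : 0 ≤ ∑ x ∈ Ω, (h x)^r := Finset.sum_nonneg fun x _ => Real.rpow_nonneg (hh x) _
  have B0 : 0 ≤ ∑ x ∈ Ω, |a x|^p := Finset.sum_nonneg fun x _ => Real.rpow_nonneg (abs_nonneg _) _
  have n1 : 0 ≤ 1 - 2/p := by rw [← c1]; positivity
  refine H.trans ?_
  have u1 := Real.rpow_le_rpow (Finset.sum_nonneg fun x _ =>
    Real.rpow_nonneg (mV_nonneg hh _ _) _) d1 n1
  have u2 := Real.rpow_le_rpow (Finset.sum_nonneg fun x _ =>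
    Real.rpow_nonneg (mV_nonneg (fun _ => abs_nonneg _) _ _) _) d2 (show 0 ≤ 2/p by positivity)
  rw [Real.mul_rpow (by positivity) A0, ← Real.rpow_mul (by positivity)] at u1
  rw [Real.mul_rpow (by positivity) B0, ← Real.rpow_mul (by positivity)] at u2
  rw [show r * (1-2/p) = 1 by rw [← c1]; field_simp, Real.rpow_one] at u1
  rw [show p * (2/p) = (2:ℕ) by push_cast; field_simp, Real.rpow_natCast] at u2
  refine (mul_le_mul u1 u2 (Real.rpow_nonneg (Finset.sum_nonneg fun x _ =>
    Real.rpow_nonneg (mV_nonneg (fun _ => abs_nonneg _) _ _) _) _) (by positivity)).trans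
    (le_of_eq (by ring))

lemma Zreal {p : ℝ} (hp : 2 ≤ p) : ∃ C : ℝ, 0 < C ∧ ∀ (M N L : ℕ) (n : ℕ → ℕ), StrictMono n →
    (∀ i, 0 < n i) → L + n N ≤ M → ∀ a : ℕ → ℝ,
    ∑ k ∈ range L, (Sq N n a k)^(p/2) ≤ C * ∑ k ∈ range M, |a k|^p := by
  have hp0 : 0 < p := by linarith
  rcases hp.eq_or_lt with rfl | hp
  · refine ⟨172100 * 8, by norm_num, fun M N L n hn hpos hL a => ?_⟩
    set h : ℕ → ℝ := fun k => if k < L then 1 else 0 with hh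
    have h0 : ∀ x, 0 ≤ h x := fun x => by simp only [hh]; split_ifs <;> norm_num
    have h1 : ∀ x, h x ≤ 1 := fun x => by simp only [hh]; split_ifs <;> norm_num
    obtain ⟨J, w⟩ := weighted M N L n hn hpos hL a h h0 (fun k hk => by simp [hh, hk])
    have e1 : ∑ k ∈ range L, (Sq N n a k)^((2:ℝ)/2) = ∑ k ∈ range M, h k * Sq N n a k := by
      have : range L = (range M).filter (fun k => k < L) := by
        ext k; simp only [mem_filter, mem_range]; omega
      rw [this, Finset.sum_filter]
      refine Finset.sum_congr rfl fun k _ => ?_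
      simp only [hh]; split_ifs <;> simp
    rw [e1]
    refine w.trans ?_
    rw [mul_assoc]
    refine mul_le_mul_of_nonneg_left ?_ (by norm_num)
    have d := doob (Ω := range M) (gr_nest J 0) (h := fun y => |a y|) (fun _ => abs_nonneg _)
      (show (1:ℝ) < 2 by norm_num) J
    norm_num at d
    norm_num
    have : ∑ k ∈ range M,
      (mV (range M) (gr J 0) h J k * (mV (range M) (gr J 0) (fun y => |a y|) J k)^2 +
       mV (range M) (gr J (c1 J)) h J k * (mV (range M) (gr J 0) (fun y => |a y|) J k)^2) ≤
       2 * ∑ k ∈ range M, (mV (range M) (gr J 0) (fun y => |a y|) J k)^2 := by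
      rw [Finset.mul_sum]
      refine Finset.sum_le_sum fun k _ => ?_
      have u := mV_le_one (range M) (gr J 0) h h1 J k
      have v := mV_le_one (range M) (gr J (c1 J)) h h1 J k
      nlinarith [sq_nonneg (mV (range M) (gr J 0) (fun y => |a y|) J k)]
    linarith
  · have hp2 : 0 < p - 2 := by linarith
    have hp1 : 0 < p - 1 := by linarith
    set K : ℝ := 172100 * (2 * ((p/2) * (p/(p-1))^2)) with hK
    have hK0 : 0 < K := by positivity
    refine ⟨K^(p/2), by positivity, fun M N L n hn hpos hL a => ?_⟩
    set h : ℕ → ℝ := fun k => if k < L then (Sq N n a k)^(p/2-1) else 0 with hh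
    have h0 : ∀ x, 0 ≤ h x := fun x => by
      simp only [hh]; split_ifs
      · exact Real.rpow_nonneg (Sq_nonneg _ _ _ _) _
      · exact le_rfl
    obtain ⟨J, w⟩ := weighted M N L n hn hpos hL a h h0 (fun k hk => by simp [hh, hk])
    have eL : range L = (range M).filter (fun k => k < L) := by
      ext k; simp only [mem_filter, mem_range]; omega
    set Y := ∑ k ∈ range L, (Sq N n a k)^(p/2) with hY
    set A := ∑ k ∈ range M, |a k|^p with hA
    have A0 : 0 ≤ A := Finset.sum_nonneg fun x _ => Real.rpow_nonneg (abs_nonneg _) _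
    have Y0 : 0 ≤ Y := Finset.sum_nonneg fun x _ => Real.rpow_nonneg (Sq_nonneg _ _ _ _) _
    have e1 : Y = ∑ k ∈ range M, h k * Sq N n a k := by
      rw [hY, eL, Finset.sum_filter]
      refine Finset.sum_congr rfl fun k _ => ?_
      simp only [hh]; split_ifs
      · rw [← Real.rpow_add_one' (Sq_nonneg _ _ _ _) (by linarith)]; ring_nf
      · simp
    have e2 : ∑ x ∈ range M, (h x)^(p/(p-2)) = Y := by
      rw [hY, eL, Finset.sum_filter]
      refine Finset.sum_congr rfl fun k _ => ?_
      simp only [hh]; split_ifs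
      · rw [← Real.rpow_mul (Sq_nonneg _ _ _ _)]; congr 1; field_simp
      · exact Real.zero_rpow (by positivity)
    have k0 := hold (Ω := range M) (gr_nest J 0) (gr_nest J 0) hp J a h h0
    have k1 := hold (Ω := range M) (gr_nest J 0) (gr_nest J (c1 J)) hp J a h h0
    rw [e2] at k0 k1
    rw [← e1, Finset.sum_add_distrib] at w
    have main : Y ≤ K * (Y^(1-2/p) * A^(2/p)) := by
      rw [hK]; linarith
    rcases Y0.eq_or_lt with hY0 | hYp
    · rw [← hY0]; positivity
    have main2 : Y^(2/p) ≤ K * A^(2/p) := by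
      have hpos' : 0 < Y^(1-2/p) := Real.rpow_pos_of_pos hYp _
      refine le_of_mul_le_mul_left ?_ hpos'
      rw [← Real.rpow_add hYp, show 1 - 2/p + 2/p = 1 by ring, Real.rpow_one]
      linarith
    have := Real.rpow_le_rpow (by positivity) main2 (show 0 ≤ p/2 by positivity)
    rw [Real.mul_rpow hK0.le (by positivity), ← Real.rpow_mul Y0, ← Real.rpow_mul A0,
      show 2/p*(p/2) = 1 by field_simp, Real.rpow_one, Real.rpow_one] at this
    exact this

end QME

namespace QME

/-- weights of the difference of two averages -/
noncomputable def wt (n : ℕ → ℕ) (j i : ℕ) : ℝ :=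
  (if i ≤ n j then 1 / ((n j : ℝ) + 1) else 0) -
    (if i ≤ n (j+1) then 1 / ((n (j+1) : ℝ) + 1) else 0)

/-- vector of weights -/
noncomputable def wv (N : ℕ) (n : ℕ → ℕ) (i : ℕ) : EuclideanSpace ℂ (Fin N) :=
  WithLp.toLp 2 (fun j => (wt n j i : ℂ))

lemma av_sum (a : ℕ → ℝ) (k l m : ℕ) (hl : l < m) :
    ∑ i ∈ range m, a (k+i) * (if i ≤ l then 1 / ((l : ℝ) + 1) else 0) = av a k (k + l + 1) := by
  have : ∀ i ∈ range m, a (k+i) * (if i ≤ l then 1 / ((l : ℝ) + 1) else 0) =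
      if i ≤ l then a (k+i) / ((l:ℝ)+1) else 0 := by
    intro i _; split_ifs
    · ring
    · simp
  rw [Finset.sum_congr rfl this, ← Finset.sum_filter]
  have e : (range m).filter (fun i => i ≤ l) = range (l+1) := by
    ext i; simp only [mem_filter, mem_range]; omega
  rw [e, av, Finset.sum_Ico_eq_sum_range, ← Finset.sum_div, show k + l + 1 - k = l + 1 by omega]
  congr 1
  push_cast; ring

lemma wt_sum (n : ℕ → ℕ) (hn : StrictMono n) (N j : ℕ) (hj : j < N) (a : ℕ → ℝ) (k : ℕ) :
    ∑ i ∈ range (n N + 1), a (k+i) * wt n j i = av a k (k + n j + 1) - av a k (k + n (j+1) + 1) := by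
  have h1 : n j < n N + 1 := by have := hn.monotone hj.le; omega
  have h2 : n (j+1) < n N + 1 := by have := hn.monotone (show j + 1 ≤ N by omega); omega
  rw [← av_sum a k (n j) _ h1, ← av_sum a k (n (j+1)) _ h2, ← Finset.sum_sub_distrib]
  exact Finset.sum_congr rfl fun i _ => by rw [wt]; ring

lemma norm_wv (N : ℕ) (n : ℕ → ℕ) (hn : StrictMono n) (z : ℕ → ℂ) (k : ℕ) :
    ‖∑ i ∈ range (n N + 1), z (k+i) • wv N n i‖^2 =
      Sq N n (fun i => (z i).re) k + Sq N n (fun i => (z i).im) k := by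
  rw [EuclideanSpace.norm_sq_eq, Sq, Sq, ← Finset.sum_add_distrib,
    ← Fin.sum_univ_eq_sum_range (fun i =>
      (av (fun i => (z i).re) k (k + n i + 1) - av (fun i => (z i).re) k (k + n (i+1) + 1))^2 +
      (av (fun i => (z i).im) k (k + n i + 1) - av (fun i => (z i).im) k (k + n (i+1) + 1))^2) N]
  refine Finset.sum_congr rfl fun j _ => ?_
  have e : (∑ i ∈ range (n N + 1), z (k+i) • wv N n i) j =
      ∑ i ∈ range (n N + 1), z (k+i) * (wt n j i : ℂ) := by
    simp [wv]
  rw [e, Complex.sq_norm, Complex.normSq_apply, Complex.re_sum, Complex.im_sum]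
  simp only [Complex.re_mul_ofReal, Complex.im_mul_ofReal]
  rw [wt_sum n hn N j j.2 (fun i => (z i).re) k, wt_sum n hn N j j.2 (fun i => (z i).im) k]
  ring

lemma Zc {p : ℝ} (hp : 2 ≤ p) : ∃ C : ℝ, 0 < C ∧ ∀ (N L : ℕ) (n : ℕ → ℕ), StrictMono n →
    (∀ i, 0 < n i) → ∀ z : ℕ → ℂ,
    ∑ k ∈ range L, ‖∑ i ∈ range (n N + 1), z (k+i) • wv N n i‖^p ≤
      C * ∑ k ∈ range (L + (n N + 1)), ‖z k‖^p := by
  obtain ⟨C, hC, H⟩ := Zreal hp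
  refine ⟨2^(p/2) * (2*C), by positivity, fun N L n hn hpos z => ?_⟩
  have hr := H (L + (n N + 1)) N L n hn hpos (by omega) (fun i => (z i).re)
  have hi := H (L + (n N + 1)) N L n hn hpos (by omega) (fun i => (z i).im)
  have hpt : ∀ k ∈ range L, ‖∑ i ∈ range (n N + 1), z (k+i) • wv N n i‖^p ≤
      2^(p/2) * ((Sq N n (fun i => (z i).re) k)^(p/2) + (Sq N n (fun i => (z i).im) k)^(p/2)) := by
    intro k _
    have e : ‖∑ i ∈ range (n N + 1), z (k+i) • wv N n i‖^p =
        (‖∑ i ∈ range (n N + 1), z (k+i) • wv N n i‖^2)^(p/2) := by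
      rw [← Real.rpow_natCast, ← Real.rpow_mul (norm_nonneg _)]; congr 1; push_cast; ring
    rw [e, norm_wv N n hn]
    have x0 := Sq_nonneg N n (fun i => (z i).re) k
    have y0 := Sq_nonneg N n (fun i => (z i).im) k
    generalize Sq N n (fun i => (z i).re) k = x at *
    generalize Sq N n (fun i => (z i).im) k = y at *
    have q : 0 ≤ p/2 := by linarith
    have X := Real.rpow_nonneg x0 (p/2)
    have Y := Real.rpow_nonneg y0 (p/2)
    have two : (0:ℝ) < 2^(p/2) := by positivity
    rcases le_total x y with hxy | hxy
    · calc (x+y)^(p/2) ≤ (2*y)^(p/2) := Real.rpow_le_rpow (by linarith) (by linarith) q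
        _ = 2^(p/2) * y^(p/2) := Real.mul_rpow (by norm_num) y0
        _ ≤ _ := by gcongr; linarith
    · calc (x+y)^(p/2) ≤ (2*x)^(p/2) := Real.rpow_le_rpow (by linarith) (by linarith) q
        _ = 2^(p/2) * x^(p/2) := Real.mul_rpow (by norm_num) x0
        _ ≤ _ := by gcongr; linarith
  have s := Finset.sum_le_sum hpt
  rw [← Finset.mul_sum, Finset.sum_add_distrib] at s
  refine s.trans ?_
  rw [mul_assoc]
  refine mul_le_mul_of_nonneg_left ?_ (by positivity)
  have b1 : ∑ k ∈ range (L + (n N + 1)), |(z k).re|^p ≤ ∑ k ∈ range (L + (n N + 1)), ‖z k‖^p :=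
    Finset.sum_le_sum fun k _ => Real.rpow_le_rpow (abs_nonneg _) (Complex.abs_re_le_norm _)
      (by linarith)
  have b2 : ∑ k ∈ range (L + (n N + 1)), |(z k).im|^p ≤ ∑ k ∈ range (L + (n N + 1)), ‖z k‖^p :=
    Finset.sum_le_sum fun k _ => Real.rpow_le_rpow (abs_nonneg _) (Complex.abs_im_le_norm _)
      (by linarith)
  nlinarith

end QME

namespace QME

section lpsec
variable {X : Type*} [MeasurableSpace X] {μ : Measure X} {p : ℝ≥0∞} [Fact (1 ≤ p)]
variable {E : Type*} [NormedAddCommGroup E] [NormedSpace ℂ E]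

/-- tensor of a scalar function with a vector -/
noncomputable def tn (v : E) : Lp ℂ p μ →L[ℂ] Lp E p μ :=
  (ContinuousLinearMap.toSpanSingleton ℂ v).compLpL p μ

lemma tn_coe (v : E) (f : Lp ℂ p μ) : ∀ᵐ x ∂μ, tn v f x = f x • v := by
  have := ContinuousLinearMap.coeFn_compLpL (p := p) (μ := μ)
    (ContinuousLinearMap.toSpanSingleton ℂ v) f
  filter_upwards [this] with x hx
  rw [tn, hx]; simp

lemma norm_tn (v : E) (f : Lp ℂ p μ) : ‖tn v f‖ = ‖v‖ * ‖f‖ := by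
  have : eLpNorm (tn v f) p μ = ‖v‖ₑ * eLpNorm f p μ := by
    have h1 : eLpNorm (tn v f) p μ = eLpNorm (((‖v‖ : ℝ) : ℂ) • (f : X → ℂ)) p μ := by
      apply eLpNorm_congr_norm_ae
      filter_upwards [tn_coe v f] with x hx
      rw [hx, norm_smul]; simp [mul_comm]
    rw [h1, eLpNorm_const_smul]
    congr 1
    simp [enorm_eq_nnnorm]
  rw [Lp.norm_def, Lp.norm_def, this, ENNReal.toReal_mul]; simp

lemma norm_add_disj (hp' : p ≠ ∞) (u w : Lp E p μ) (h : ∀ᵐ x ∂μ, u x = 0 ∨ w x = 0) :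
    ‖u + w‖^p.toReal = ‖u‖^p.toReal + ‖w‖^p.toReal := by
  have h1 : (1:ℝ≥0∞) ≤ p := Fact.out
  have hp0 : p ≠ 0 := (zero_lt_one.trans_le h1).ne'
  have hP : 0 < p.toReal := ENNReal.toReal_pos hp0 hp'
  have key : eLpNorm (u+w : Lp E p μ) p μ ^ p.toReal =
      eLpNorm u p μ ^ p.toReal + eLpNorm w p μ ^ p.toReal := by
    simp only [eLpNorm_eq_lintegral_rpow_enorm_toReal hp0 hp', ← ENNReal.rpow_mul,
      one_div, inv_mul_cancel₀ hP.ne', ENNReal.rpow_one]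
    rw [← lintegral_add_left' ((Lp.aestronglyMeasurable u).enorm.pow_const _)]
    apply lintegral_congr_ae
    filter_upwards [h, Lp.coeFn_add u w] with x hx hx2
    rw [hx2]
    rcases hx with hx | hx <;> simp [hx, hP]
  simp only [Lp.norm_def]
  rw [ENNReal.toReal_rpow, ENNReal.toReal_rpow, ENNReal.toReal_rpow, key, ENNReal.toReal_add]
  · exact ENNReal.rpow_ne_top_of_nonneg hP.le (Lp.eLpNorm_ne_top u)
  · exact ENNReal.rpow_ne_top_of_nonneg hP.le (Lp.eLpNorm_ne_top w)

lemma coe_sum {F ι : Type*} [NormedAddCommGroup F] (s : Finset ι) (f : ι → Lp F p μ) :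
    ∀ᵐ x ∂μ, (∑ i ∈ s, f i : Lp F p μ) x = ∑ i ∈ s, f i x := by
  classical
  induction s using Finset.induction_on with
  | empty =>
    filter_upwards [Lp.coeFn_zero F p μ] with x hx
    simpa using hx
  | insert a s ha ih =>
    rw [Finset.sum_insert ha]
    filter_upwards [ih, Lp.coeFn_add (f a) (∑ i ∈ s, f i)] with x h1 h2
    rw [h2, Pi.add_apply, h1, Finset.sum_insert ha]

/-- linear combination of a tuple with vector coefficients -/
noncomputable def HH (m : ℕ) (v : ℕ → E) (f : ℕ → Lp ℂ p μ) : Lp E p μ :=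
  ∑ i ∈ range m, tn (v i) (f i)

lemma HH_zero (m : ℕ) (v : ℕ → E) (f g : ℕ → Lp ℂ p μ)
    (h : ∀ i j, ∀ᵐ x ∂μ, f i x * g j x = 0) :
    ∀ᵐ x ∂μ, HH m v f x = 0 ∨ HH m v g x = 0 := by
  have c : ∀ f : ℕ → Lp ℂ p μ, ∀ᵐ x ∂μ, HH m v f x = ∑ i ∈ range m, f i x • v i := by
    intro f
    have h2 : ∀ᵐ x ∂μ, ∀ i, tn (v i) (f i) x = f i x • v i := ae_all_iff.2 fun i => tn_coe _ _
    have h3 := coe_sum (range m) (fun i => tn (v i) (f i))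
    filter_upwards [h2, h3] with x hx hx3
    rw [HH, hx3]
    simp [hx]
  have h' : ∀ᵐ x ∂μ, ∀ i j, f i x * g j x = 0 := ae_all_iff.2 fun i => ae_all_iff.2 (h i)
  filter_upwards [c f, c g, h'] with x h1 h2 h3
  rw [h1, h2]
  by_cases hf : ∀ i, f i x = 0
  · left; simp [hf]
  · right
    push Not at hf
    obtain ⟨i, hi⟩ := hf
    have : ∀ j, g j x = 0 := fun j => (mul_eq_zero.1 (h3 i j)).resolve_left hi
    simp [this]

lemma HH_ind (m : ℕ) (v : ℕ → E) (c : ℕ → ℂ) (g : Lp ℂ p μ) :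
    ‖HH m v (fun i => c i • g)‖ = ‖∑ i ∈ range m, c i • v i‖ * ‖g‖ := by
  rw [← norm_tn]
  congr 1
  have h2 : ∀ᵐ x ∂μ, ∀ i, tn (v i) (c i • g) x = (c i • g : Lp ℂ p μ) x • v i :=
    ae_all_iff.2 fun i => tn_coe _ _
  have h3 := coe_sum (range m) (fun i => tn (v i) (c i • g))
  have h4 : ∀ᵐ x ∂μ, ∀ i, (c i • g : Lp ℂ p μ) x = c i • g x :=
    ae_all_iff.2 fun i => Lp.coeFn_smul _ _
  apply Lp.ext
  filter_upwards [h2, h3, h4, tn_coe (∑ i ∈ range m, c i • v i) g] with x a2 a3 a4 a5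
  rw [HH, a3, a5, Finset.smul_sum]
  refine Finset.sum_congr rfl fun i _ => ?_
  rw [a2, a4, smul_smul, smul_eq_mul, mul_comm]

/-- coordinate of a tuple valued function -/
noncomputable def pj (m : ℕ) (i : ℕ) : Lp (Fin m → ℂ) p μ →L[ℂ] Lp ℂ p μ :=
  if h : i < m then
    (ContinuousLinearMap.proj (R := ℂ) (φ := fun _ : Fin m => ℂ) ⟨i, h⟩).compLpL p μ else 0

lemma pj_coe (m i : ℕ) (f : Lp (Fin m → ℂ) p μ) :
    ∀ᵐ x ∂μ, pj m i f x = if h : i < m then f x ⟨i, h⟩ else 0 := by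
  unfold pj
  split_ifs with h
  · filter_upwards [ContinuousLinearMap.coeFn_compLpL (p := p) (μ := μ)
      (ContinuousLinearMap.proj (R := ℂ) (φ := fun _ : Fin m => ℂ) ⟨i, h⟩) f] with x hx
    rw [hx]; simp
  · filter_upwards [Lp.coeFn_zero ℂ p μ] with x hx
    simpa using hx

lemma pj_surj (m : ℕ) (f : ℕ → Lp ℂ p μ) : ∃ F : Lp (Fin m → ℂ) p μ, ∀ i < m, pj m i F = f i := by
  refine ⟨∑ j : Fin m, (ContinuousLinearMap.single ℂ (fun _ : Fin m => ℂ) j).compLpL p μ (f j),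
    fun i hi => ?_⟩
  apply Lp.ext
  have h2 : ∀ᵐ x ∂μ, ∀ j : Fin m,
      ((ContinuousLinearMap.single ℂ (fun _ : Fin m => ℂ) j).compLpL p μ (f j)) x =
      Pi.single j (f j x) := ae_all_iff.2 fun j => by
    filter_upwards [ContinuousLinearMap.coeFn_compLpL (p := p) (μ := μ)
      (ContinuousLinearMap.single ℂ (fun _ : Fin m => ℂ) j) (f j)] with x hx
    rw [hx]; simp
  filter_upwards [h2, pj_coe m i (∑ j : Fin m,
    (ContinuousLinearMap.single ℂ (fun _ : Fin m => ℂ) j).compLpL p μ (f j)),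
    coe_sum univ (fun j : Fin m =>
      (ContinuousLinearMap.single ℂ (fun _ : Fin m => ℂ) j).compLpL p μ (f j))] with x a1 a2 a3
  rw [a2, dif_pos hi, a3]
  simp [a1, Finset.sum_apply, Pi.single_apply]

lemma HH_congr (m : ℕ) (v : ℕ → E) (f g : ℕ → Lp ℂ p μ) (h : ∀ i < m, f i = g i) :
    HH m v f = HH m v g :=
  Finset.sum_congr rfl fun i hi => by rw [h i (mem_range.1 hi)]

lemma HH_add (m : ℕ) (v : ℕ → E) (f g : ℕ → Lp ℂ p μ) :
    HH m v (fun i => f i + g i) = HH m v f + HH m v g := by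
  simp [HH, Finset.sum_add_distrib]

lemma lemA (hp' : p ≠ ∞) (S : Lp ℂ p μ →L[ℂ] Lp ℂ p μ) (hS : ‖S‖ ≤ 1) (hL : IsLamperti S)
    {ι : Type*} (R : Finset ι) (σ : ι → ℝ) (m : ℕ) (v : ι → ℕ → E)
    (hΦ : ∀ z : ℕ → ℂ, 0 ≤ ∑ r ∈ R, σ r * ‖∑ i ∈ range m, z i • v r i‖^p.toReal)
    (f : ℕ → Lp ℂ p μ) :
    ∑ r ∈ R, σ r * ‖HH m (v r) (fun i => S (f i))‖^p.toReal ≤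
      ∑ r ∈ R, σ r * ‖HH m (v r) f‖^p.toReal := by
  have h1 : (1:ℝ≥0∞) ≤ p := Fact.out
  have hp0 : p ≠ 0 := (zero_lt_one.trans_le h1).ne'
  have hP : 0 < p.toReal := ENNReal.toReal_pos hp0 hp'
  obtain ⟨F, hF⟩ := pj_surj m f
  suffices H : ∀ F : Lp (Fin m → ℂ) p μ,
      ∑ r ∈ R, σ r * ‖HH m (v r) (fun i => S (pj m i F))‖^p.toReal ≤
      ∑ r ∈ R, σ r * ‖HH m (v r) (fun i => pj m i F)‖^p.toReal by
    have := H F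
    simp only [HH_congr m _ (fun i => pj m i F) f hF,
      HH_congr m _ (fun i => S (pj m i F)) (fun i => S (f i)) (fun i hi => by rw [hF i hi])] at this
    exact this
  intro F
  induction F using Lp.induction hp' with
  | @indicatorConst c s hs hμs =>
    set g : Lp ℂ p μ := indicatorConstLp p hs hμs.ne (1:ℂ) with hg
    set c' : ℕ → ℂ := fun i => if h : i < m then c ⟨i, h⟩ else 0 with hc'
    have e : ∀ i, pj m i ((Lp.simpleFunc.indicatorConst p hs hμs.ne c : Lp.simpleFunc (Fin m → ℂ) p μ) : Lp (Fin m → ℂ) p μ) = c' i • g := by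
      intro i
      apply Lp.ext
      filter_upwards [pj_coe m i ((Lp.simpleFunc.indicatorConst p hs hμs.ne c : Lp.simpleFunc (Fin m → ℂ) p μ) : Lp (Fin m → ℂ) p μ), Lp.coeFn_smul (c' i) g,
        (indicatorConstLp_coeFn (p := p) (hs := hs) (hμs := hμs.ne) (c := c)),
        (indicatorConstLp_coeFn (p := p) (hs := hs) (hμs := hμs.ne) (c := (1:ℂ)))] with x a1 a2 a3 a4
      rw [a1, a2, Pi.smul_apply, hg, a4, Lp.simpleFunc.coe_indicatorConst, a3]
      by_cases hx : x ∈ s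
      · simp [hx, hc']
      · simp [hx]
    simp only [e, map_smul, HH_ind]
    simp only [Real.mul_rpow (norm_nonneg _) (norm_nonneg _), ← mul_assoc, ← Finset.sum_mul]
    refine mul_le_mul_of_nonneg_left ?_ (hΦ c')
    refine Real.rpow_le_rpow (norm_nonneg _) ?_ hP.le
    calc ‖S g‖ ≤ ‖S‖ * ‖g‖ := S.le_opNorm g
      _ ≤ 1 * ‖g‖ := by gcongr
      _ = ‖g‖ := one_mul _
  | @add f g hf hg hd h1 h2 =>
    have hdis : ∀ i j, ∀ᵐ x ∂μ, pj m i (hf.toLp f) x * pj m j (hg.toLp g) x = 0 := by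
      intro i j
      filter_upwards [pj_coe m i (hf.toLp f), pj_coe m j (hg.toLp g), hf.coeFn_toLp,
        hg.coeFn_toLp] with x a1 a2 a3 a4
      rw [a1, a2, a3, a4]
      by_cases hx : f x = 0
      · simp [hx]
      · have : g x = 0 := by
          by_contra hgx
          exact Set.disjoint_left.1 hd hx hgx
        simp [this]
    have hdS : ∀ i j, ∀ᵐ x ∂μ, S (pj m i (hf.toLp f)) x * S (pj m j (hg.toLp g)) x = 0 :=
      fun i j => hL _ _ (hdis i j)
    simp only [map_add, HH_add]
    simp only [fun r => norm_add_disj hp' _ _ (HH_zero m (v r) _ _ hdis),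
      fun r => norm_add_disj hp' _ _ (HH_zero m (v r) _ _ hdS), mul_add, Finset.sum_add_distrib]
    exact add_le_add h1 h2
  | isClosed =>
    apply isClosed_le
    · refine continuous_finsetSum _ fun r _ => continuous_const.mul ?_
      refine Continuous.rpow_const ?_ (fun _ => Or.inr hP.le)
      unfold HH; fun_prop
    · refine continuous_finsetSum _ fun r _ => continuous_const.mul ?_
      refine Continuous.rpow_const ?_ (fun _ => Or.inr hP.le)
      unfold HH; fun_prop

end lpsec
end QME

namespace QME

section exsec
variable {V : Type*} [NormedAddCommGroup V] [NormedSpace ℂ V] [NormedSpace ℝ V]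
  [IsScalarTower ℝ ℂ V] {ι : Type*} [Fintype ι]

/-- prepend an element to a sequence -/
def cn (x : V) (f : ℕ → V) : ℕ → V
  | 0 => x
  | k + 1 => f k

/-- expectation over random compositions -/
noncomputable def Ex (w : ι → ℝ) (S : ι → V →L[ℂ] V) (x : V) : ℕ → (((ℕ → V) → ℝ) →ₗ[ℝ] ℝ)
  | 0 => LinearMap.proj (R := ℝ) (φ := fun _ : ℕ → V => ℝ) (fun _ => x)
  | K + 1 => ∑ i, w i • (Ex w S x K ∘ₗ LinearMap.funLeft ℝ ℝ (fun f => cn x (fun k => S i (f k))))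

lemma Ex_zero (w : ι → ℝ) (S : ι → V →L[ℂ] V) (x : V) (G : (ℕ → V) → ℝ) :
    Ex w S x 0 G = G (fun _ => x) := rfl

lemma Ex_succ (w : ι → ℝ) (S : ι → V →L[ℂ] V) (x : V) (K : ℕ) (G : (ℕ → V) → ℝ) :
    Ex w S x (K+1) G = ∑ i, w i * Ex w S x K (fun f => G (cn x (fun k => S i (f k)))) := by
  simp only [Ex, LinearMap.sum_apply, LinearMap.smul_apply, smul_eq_mul]
  rfl

lemma Ex_mono {w : ι → ℝ} (hw : ∀ i, 0 ≤ w i) (S : ι → V →L[ℂ] V) (x : V) (K : ℕ) :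
    ∀ {G G' : (ℕ → V) → ℝ}, (∀ f, G f ≤ G' f) → Ex w S x K G ≤ Ex w S x K G' := by
  induction K with
  | zero => intro G G' h; exact h _
  | succ K ih =>
    intro G G' h
    rw [Ex_succ, Ex_succ]
    exact Finset.sum_le_sum fun i _ => mul_le_mul_of_nonneg_left (ih fun f => h _) (hw i)

lemma Ex_loc {w : ι → ℝ} (hw1 : ∑ i, w i = 1) (S : ι → V →L[ℂ] V) (x : V) (K : ℕ) :
    ∀ {G : (ℕ → V) → ℝ}, (∀ f g, (∀ k ≤ K, f k = g k) → G f = G g) →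
      Ex w S x (K+1) G = Ex w S x K G := by
  induction K with
  | zero =>
    intro G h
    rw [Ex_succ]
    simp only [Ex_zero]
    rw [Finset.sum_congr rfl (fun i _ => by
      rw [h (cn x (fun k => S i x)) (fun _ => x) (fun k hk => by
        obtain rfl : k = 0 := by omega
        rfl)]), ← Finset.sum_mul, hw1, one_mul]
  | succ K ih =>
    intro G h
    rw [Ex_succ w S x (K+1), Ex_succ w S x K]
    refine Finset.sum_congr rfl fun i _ => ?_
    rw [ih]
    intro f g hfg
    apply h
    intro k hk
    cases k with
    | zero => rfl
    | succ k => simp only [cn]; rw [hfg k (by omega)]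

lemma Ex_shift {w : ι → ℝ} (hw : ∀ i, 0 ≤ w i) (hw1 : ∑ i, w i = 1) (S : ι → V →L[ℂ] V) (x : V)
    (K : ℕ) {G : (ℕ → V) → ℝ} (hG : ∀ f g, (∀ k ≤ K, f k = g k) → G f = G g)
    (hS : ∀ i f, G (fun k => S i (f k)) ≤ G f) :
    Ex w S x (K+1) (fun f => G (fun k => f (k+1))) ≤ Ex w S x (K+1) G := by
  rw [Ex_loc hw1 S x K hG, Ex_succ]
  calc _ ≤ ∑ i, w i * Ex w S x K G :=
        Finset.sum_le_sum fun i _ => mul_le_mul_of_nonneg_left (Ex_mono hw S x K fun f => hS i f) (hw i)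
    _ = _ := by rw [← Finset.sum_mul, hw1, one_mul]

lemma Ex_convex {w : ι → ℝ} (hw : ∀ i, 0 ≤ w i) (hw1 : ∑ i, w i = 1) (S : ι → V →L[ℂ] V) (x : V)
    (T : V →L[ℂ] V) (hT : ∀ y, T y = ∑ i, w i • S i y) (K : ℕ) :
    ∀ {G : (ℕ → V) → ℝ}, (∀ f g, (∀ k ≤ K, f k = g k) → G f = G g) →
    ConvexOn ℝ Set.univ G → G (fun k => (T^k) x) ≤ Ex w S x K G := by
  induction K with
  | zero =>
    intro G h _
    rw [Ex_zero]
    refine le_of_eq (h _ _ fun k hk => ?_)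
    obtain rfl : k = 0 := by omega
    simp
  | succ K ih =>
    intro G h hc
    rw [Ex_succ]
    have h1 : ∀ i ∈ (univ : Finset ι), w i * G (cn x (fun k => S i ((T^k) x))) ≤
        w i * Ex w S x K (fun f => G (cn x (fun k => S i (f k)))) := by
      intro i _
      refine mul_le_mul_of_nonneg_left (ih (G := fun f => G (cn x (fun k => S i (f k)))) ?_ ?_) (hw i)
      · intro f g hfg
        apply h
        intro k hk
        cases k with
        | zero => rfl
        | succ k => simp only [cn]; rw [hfg k (by omega)]
      · refine ⟨convex_univ, fun f _ g _ a b ha hb hab => ?_⟩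
        have := hc.2 (Set.mem_univ (cn x (fun k => S i (f k))))
          (Set.mem_univ (cn x (fun k => S i (g k)))) ha hb hab
        refine le_trans (le_of_eq (congrArg G ?_)) this
        funext k
        cases k with
        | zero =>
          simp only [cn, Pi.add_apply, Pi.smul_apply]
          rw [← add_smul, hab, one_smul]
        | succ k =>
          simp only [cn, Pi.add_apply, Pi.smul_apply, map_add]
          rw [(S i).map_smul_of_tower, (S i).map_smul_of_tower]
    refine le_trans ?_ (Finset.sum_le_sum h1)
    have h2 := hc.map_sum_le (t := univ) (w := w) (p := fun i => cn x (fun k => S i ((T^k) x)))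
      (fun i _ => hw i) hw1 (fun i _ => Set.mem_univ _)
    refine le_trans (le_of_eq (congrArg G ?_)) (h2.trans (le_of_eq (by simp)))
    funext k
    rw [Finset.sum_apply]
    cases k with
    | zero =>
      simp only [cn, Pi.smul_apply]
      rw [← Finset.sum_smul, hw1, one_smul]; simp
    | succ k =>
      simp only [cn, Pi.smul_apply]
      rw [← hT, pow_succ']; rfl

end exsec
end QME

namespace QME

lemma window_sum {A : Type*} [AddCommMonoid A] (L m k : ℕ) (hk : k < L) (g : ℕ → ℕ → A) :
    ∑ i ∈ range (L+m), (if k ≤ i ∧ i < k + m then g (i-k) i else 0) =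
      ∑ j ∈ range m, g j (k+j) := by
  rw [← Finset.sum_filter]
  have : (range (L+m)).filter (fun i => k ≤ i ∧ i < k + m) = Ico k (k+m) := by
    ext i; simp only [mem_filter, mem_range, mem_Ico]; omega
  rw [this, Finset.sum_Ico_eq_sum_range]
  simp

section mainsec
variable {X : Type*} [MeasurableSpace X] {μ : Measure X} {p : ℝ≥0∞} [Fact (1 ≤ p)]
variable {E : Type*} [NormedAddCommGroup E] [NormedSpace ℂ E]

/-- the functional of transference -/
noncomputable def Ph (C P : ℝ) (L m : ℕ) (v : ℕ → E) (f : ℕ → Lp ℂ p μ) : ℝ :=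
  C * ∑ k ∈ range (L+m), ‖f k‖^P - ∑ k ∈ range L, ‖HH m v (fun i => f (k+i))‖^P

lemma tn_zero (f : Lp ℂ p μ) : tn (0 : E) f = 0 := by
  rw [← norm_eq_zero, norm_tn]; simp

set_option maxHeartbeats 1000000 in
lemma Ph_le (hp' : p ≠ ∞) {C : ℝ} (L m : ℕ) (v : ℕ → E) (e : E) (he : ‖e‖ = 1)
    (hZ : ∀ z : ℕ → ℂ, ∑ k ∈ range L, ‖∑ i ∈ range m, z (k+i) • v i‖^p.toReal ≤
      C * ∑ k ∈ range (L+m), ‖z k‖^p.toReal)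
    (S : Lp ℂ p μ →L[ℂ] Lp ℂ p μ) (hS : ‖S‖ ≤ 1) (hL : IsLamperti S) (f : ℕ → Lp ℂ p μ) :
    Ph C p.toReal L m v (fun k => S (f k)) ≤ Ph C p.toReal L m v f := by
  set R : Finset (ℕ ⊕ ℕ) := (range (L+m)).disjSum (range L) with hR
  set σ : ℕ ⊕ ℕ → ℝ := Sum.elim (fun _ => C) (fun _ => -1) with hσ
  set vv : ℕ ⊕ ℕ → ℕ → E := Sum.elim (fun k i => if i = k then e else 0)
    (fun k i => if k ≤ i ∧ i < k + m then v (i-k) else 0) with hvv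
  have e1 : ∀ f : ℕ → Lp ℂ p μ, ∑ r ∈ R, σ r * ‖HH (L+m) (vv r) f‖^p.toReal =
      Ph C p.toReal L m v f := by
    intro f
    rw [hR, Finset.sum_disjSum, Ph, Finset.mul_sum, sub_eq_add_neg, ← Finset.sum_neg_distrib]
    congr 1
    · refine Finset.sum_congr rfl fun k hk => ?_
      simp only [hσ, hvv, Sum.elim_inl]
      congr 2
      have : HH (L+m) (fun i => if i = k then e else 0) f = tn e (f k) := by
        rw [HH, Finset.sum_eq_single_of_mem k hk]
        · simp
        · intro b _ hb; simp only [hb, if_false]; exact tn_zero _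
      rw [this, norm_tn, he, one_mul]
    · refine Finset.sum_congr rfl fun k hk => ?_
      simp only [hσ, hvv, Sum.elim_inr]
      rw [neg_one_mul]
      congr 3
      unfold HH
      rw [← window_sum L m k (mem_range.1 hk) (fun j i => tn (v j) (f i))]
      refine Finset.sum_congr rfl fun i _ => ?_
      by_cases h : k ≤ i ∧ i < k + m
      · simp only [if_pos h]
      · simp only [if_neg h]; exact tn_zero _
  have e2 : ∀ z : ℕ → ℂ, 0 ≤ ∑ r ∈ R, σ r * ‖∑ i ∈ range (L+m), z i • vv r i‖^p.toReal := by
    intro z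
    have : ∑ r ∈ R, σ r * ‖∑ i ∈ range (L+m), z i • vv r i‖^p.toReal =
        C * ∑ k ∈ range (L+m), ‖z k‖^p.toReal -
          ∑ k ∈ range L, ‖∑ i ∈ range m, z (k+i) • v i‖^p.toReal := by
      rw [hR, Finset.sum_disjSum, Finset.mul_sum, sub_eq_add_neg, ← Finset.sum_neg_distrib]
      congr 1
      · refine Finset.sum_congr rfl fun k hk => ?_
        simp only [hσ, hvv, Sum.elim_inl]
        congr 2
        rw [Finset.sum_eq_single_of_mem k hk]
        · simp [norm_smul, he]
        · intro b _ hb; simp [hb]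
      · refine Finset.sum_congr rfl fun k hk => ?_
        simp only [hσ, hvv, Sum.elim_inr]
        rw [neg_one_mul]
        congr 3
        rw [← window_sum L m k (mem_range.1 hk) (fun j i => z i • v j)]
        refine Finset.sum_congr rfl fun i _ => ?_
        by_cases h : k ≤ i ∧ i < k + m
        · simp only [if_pos h]
        · simp only [if_neg h, smul_zero]
    rw [this]
    have := hZ z
    linarith
  have := lemA hp' S hS hL R σ (L+m) vv e2 f
  rwa [e1, e1] at this

set_option maxHeartbeats 1000000 in
lemma mainS (hp' : p ≠ ∞) {C : ℝ} (hC : 0 < C) (m : ℕ) (hm : 0 < m) (v : ℕ → E) (e : E)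
    (he : ‖e‖ = 1)
    (hZ : ∀ z : ℕ → ℂ, ∑ k ∈ range m, ‖∑ i ∈ range m, z (k+i) • v i‖^p.toReal ≤
      C * ∑ k ∈ range (m+m), ‖z k‖^p.toReal)
    (T : Lp ℂ p μ →L[ℂ] Lp ℂ p μ)
    (hT : T ∈ convexHull ℝ {S : Lp ℂ p μ →L[ℂ] Lp ℂ p μ | ‖S‖ ≤ 1 ∧ IsLamperti S})
    (x : Lp ℂ p μ) :
    ‖HH m v (fun k => (T^k) x)‖^p.toReal ≤ 3 * C * ‖x‖^p.toReal := by
  have h1 : (1:ℝ≥0∞) ≤ p := Fact.out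
  have hp0 : p ≠ 0 := (zero_lt_one.trans_le h1).ne'
  have hP : 0 < p.toReal := ENNReal.toReal_pos hp0 hp'
  have hP1 : 1 ≤ p.toReal := by
    rw [← ENNReal.toReal_one]; exact ENNReal.toReal_mono hp' h1
  obtain ⟨ι, _, w, S, hw, hw1, hS, hsum⟩ := mem_convexHull_iff_exists_fintype.1 hT
  set P := p.toReal with hPdef
  set K := 3 * m with hK
  set EX := Ex w S x (K+1) with hEX
  -- functionals
  set B : ℕ → (ℕ → Lp ℂ p μ) → ℝ := fun k f => ‖HH m v (fun i => f (k+i))‖^P with hB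
  set U : ℕ → (ℕ → Lp ℂ p μ) → ℝ := fun k f => ‖f k‖^P with hU
  have hUstep : ∀ k ≤ K, EX (U (k+1)) ≤ EX (U k) := by
    intro k hk
    refine Ex_shift hw hw1 S x K (G := U k) (fun f g h => by simp only [hU]; rw [h k hk]) ?_
    intro i f
    refine Real.rpow_le_rpow (norm_nonneg _) ?_ hP.le
    calc ‖S i (f k)‖ ≤ ‖S i‖ * ‖f k‖ := (S i).le_opNorm _
      _ ≤ 1 * ‖f k‖ := by gcongr; exact (hS i).1
      _ = ‖f k‖ := one_mul _
  have hBstep : ∀ k, k + m ≤ K + 1 → EX (B (k+1)) ≤ EX (B k) := by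
    intro k hk
    have := Ex_shift hw hw1 S x K (G := B k) (fun f g h => by
      simp only [hB]
      rw [HH_congr m v (fun i => f (k+i)) (fun i => g (k+i)) (fun i hi => h _ (by omega))]) (by
      intro i f
      have := lemA hp' (S i) (hS i).1 (hS i).2 (univ : Finset Unit) (fun _ => 1) m (fun _ => v)
        (fun z => by simp only [one_mul]; positivity) (fun j => f (k+j))
      simpa [hB] using this)
    refine le_trans (le_of_eq (congrArg EX ?_)) this
    funext f
    simp only [hB]
    congr 3
    funext i
    congr 1; omega
  have hPh : ∀ f : ℕ → Lp ℂ p μ, Ph C P m m v f =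
      (C • ∑ k ∈ range (m+m), U k - ∑ k ∈ range m, B k) f := by
    intro f
    simp [Ph, hU, hB, Finset.sum_apply]
  have hPh1 : ∀ f : ℕ → Lp ℂ p μ, Ph C P m m v (fun k => f (k+1)) =
      (C • ∑ k ∈ range (m+m), U (k+1) - ∑ k ∈ range m, B (k+1)) f := by
    intro f
    simp only [Ph, hU, hB, Finset.sum_apply, Pi.sub_apply, Pi.smul_apply, smul_eq_mul]
    congr 1
    refine Finset.sum_congr rfl fun k _ => ?_
    congr 3
    funext i
    congr 1; omega
  have s1 := Ex_shift hw hw1 S x K (G := Ph C P m m v) (fun f g h => by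
      unfold Ph
      congr 1
      · congr 1
        exact Finset.sum_congr rfl fun k hk => by rw [h k (by have := mem_range.1 hk; omega)]
      · refine Finset.sum_congr rfl fun k hk => ?_
        have := mem_range.1 hk
        rw [HH_congr m v (fun i => f (k+i)) (fun i => g (k+i)) (fun i hi => h _ (by omega))])
    (fun i f => Ph_le hp' m m v e he hZ (S i) (hS i).1 (hS i).2 f)
  rw [funext hPh1, funext hPh] at s1
  change EX (C • ∑ k ∈ range (m+m), U (k+1) - ∑ k ∈ range m, B (k+1)) ≤
    EX (C • ∑ k ∈ range (m+m), U k - ∑ k ∈ range m, B k) at s1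
  simp only [map_sub, map_smul, map_sum, smul_eq_mul] at s1
  have t1 := Finset.sum_range_succ (fun k => EX (U k)) (m+m)
  rw [Finset.sum_range_succ'] at t1
  have t2 := Finset.sum_range_succ (fun k => EX (B k)) m
  rw [Finset.sum_range_succ'] at t2
  have uN : 0 ≤ EX (U (m+m)) := by
    have := Ex_mono hw S x (K+1) (G := 0) (G' := U (m+m)) (fun f => by
      simp only [hU, Pi.zero_apply]; positivity)
    simpa using this
  have u0 : EX (U 0) = ‖x‖^P := by
    have : ∀ K, Ex w S x K (U 0) = ‖x‖^P := by
      intro K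
      cases K with
      | zero => rfl
      | succ K =>
        have h0 : ∀ K, Ex w S x K (fun _ => ‖x‖^P) = ‖x‖^P := by
          intro K
          induction K with
          | zero => rfl
          | succ K ih => rw [Ex_succ]; simp only [ih]; rw [← Finset.sum_mul, hw1, one_mul]
        rw [Ex_succ]
        simp only [hU, cn, h0]
        rw [← Finset.sum_mul, hw1, one_mul]
    exact this _
  have uk : ∀ k ≤ K, EX (U k) ≤ ‖x‖^P := by
    intro k
    induction k with
    | zero => intro _; exact u0.le
    | succ k ih => intro hk; exact (hUstep k (by omega)).trans (ih (by omega))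
  have b1 : EX (B 0) ≤ EX (B m) + C * ‖x‖^P := by
    have : C * EX (U (m+m)) ≥ 0 := by positivity
    rw [u0] at t1
    have t1' : ∑ k ∈ range (m+m), EX (U (k+1)) =
      ∑ k ∈ range (m+m), EX (U k) + EX (U (m+m)) - ‖x‖^P := by linarith
    rw [t1'] at s1
    nlinarith
  -- averaging
  have bmon : ∀ j k, j ≤ k → k + m ≤ K + 2 → EX (B k) ≤ EX (B j) := by
    intro j k hjk
    induction k, hjk using Nat.le_induction with
    | base => intro _; exact le_rfl
    | succ k _ ih => intro hk; exact (hBstep k (by omega)).trans (ih (by omega))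
  have s2 : ∑ k ∈ range m, EX (B k) ≤ C * ∑ k ∈ range (m+m), EX (U k) := by
    have hnn : ∀ f : ℕ → Lp ℂ p μ, 0 ≤ Ph C P m m v f := by
      intro f
      have := Ph_le hp' m m v e he hZ (0 : Lp ℂ p μ →L[ℂ] Lp ℂ p μ) (by simp)
        (fun a b _ => by
          filter_upwards [Lp.coeFn_zero ℂ p μ] with y hy
          rw [_root_.zero_apply, hy]; simp) f
      refine le_trans (le_of_eq ?_) this
      simp [Ph, HH, ← hPdef, hP.ne']
    have := Ex_mono hw S x (K+1) (G := 0) (G' := Ph C P m m v) hnn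
    rw [funext hPh] at this
    change EX 0 ≤ EX (C • ∑ k ∈ range (m+m), U k - ∑ k ∈ range m, B k) at this
    simp only [map_sub, map_smul, map_sum, smul_eq_mul, map_zero] at this
    linarith
  have s3 : m * EX (B m) ≤ ∑ k ∈ range m, EX (B k) := by
    calc m * EX (B m) = ∑ k ∈ range m, EX (B m) := by simp
      _ ≤ _ := Finset.sum_le_sum fun k hk => bmon k m (mem_range.1 hk).le (by omega)
  have s4 : ∑ k ∈ range (m+m), EX (U k) ≤ (m+m : ℕ) * ‖x‖^P := by
    calc _ ≤ ∑ k ∈ range (m+m), ‖x‖^P :=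
          Finset.sum_le_sum fun k hk => uk k (by have := mem_range.1 hk; omega)
      _ = _ := by simp
  have b2 : EX (B m) ≤ 2 * C * ‖x‖^P := by
    have hm' : (0:ℝ) < m := by exact_mod_cast hm
    refine le_of_mul_le_mul_left ?_ hm'
    push_cast at s4
    have := mul_le_mul_of_nonneg_left s4 hC.le
    nlinarith
  -- convexity
  have hconv : ‖HH m v (fun k => (T^k) x)‖^P ≤ EX (B 0) := by
    have := Ex_convex hw hw1 S x T (fun y => by
      rw [← hsum, _root_.sum_apply]; rfl) (K+1) (G := B 0) (fun f g h => by
        simp only [hB]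
        rw [HH_congr m v (fun i => f (0+i)) (fun i => g (0+i)) (fun i hi => h _ (by omega))]) ?_
    · simpa [hB] using this
    · refine ⟨convex_univ, fun f _ g _ a b ha hb hab => ?_⟩
      simp only [hB, zero_add, smul_eq_mul]
      have e : HH m v (fun i => (a • f + b • g) i) = a • HH m v f + b • HH m v g := by
        simp only [HH, Pi.add_apply, Pi.smul_apply, map_add, Finset.sum_add_distrib,
          Finset.smul_sum]
        congr 1 <;> exact Finset.sum_congr rfl fun i _ =>
          ContinuousLinearMap.map_smul_of_tower _ _ _
      rw [e]
      have n1 : ‖a • HH m v f + b • HH m v g‖ ≤ a * ‖HH m v f‖ + b * ‖HH m v g‖ := by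
        refine (norm_add_le _ _).trans ?_
        rw [norm_smul, norm_smul, Real.norm_of_nonneg ha, Real.norm_of_nonneg hb]
      refine (Real.rpow_le_rpow (norm_nonneg _) n1 hP.le).trans ?_
      exact (convexOn_rpow hP1).2 (norm_nonneg _) (norm_nonneg _) ha hb hab
  linarith

end mainsec
end QME

namespace QME

section finalsec
variable {X : Type*} [MeasurableSpace X] {μ : Measure X} {p : ℝ≥0∞} [Fact (1 ≤ p)]
variable {E : Type*} [NormedAddCommGroup E] [NormedSpace ℂ E]

lemma hull_norm (S : Lp ℂ p μ →L[ℂ] Lp ℂ p μ)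
    (hS : S ∈ convexHull ℝ {S : Lp ℂ p μ →L[ℂ] Lp ℂ p μ | ‖S‖ ≤ 1 ∧ IsLamperti S}) :
    ‖S‖ ≤ 1 := by
  have h : convexHull ℝ {S : Lp ℂ p μ →L[ℂ] Lp ℂ p μ | ‖S‖ ≤ 1 ∧ IsLamperti S} ⊆
      Metric.closedBall 0 1 :=
    convexHull_min (fun A hA => by simpa using hA.1) (convex_closedBall 0 1)
  simpa using h hS

lemma limT (hp' : p ≠ ∞) {C : ℝ} (hC : 0 < C) (m : ℕ) (hm : 0 < m) (v : ℕ → E) (e : E)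
    (he : ‖e‖ = 1)
    (hZ : ∀ z : ℕ → ℂ, ∑ k ∈ range m, ‖∑ i ∈ range m, z (k+i) • v i‖^p.toReal ≤
      C * ∑ k ∈ range (m+m), ‖z k‖^p.toReal)
    (T : Lp ℂ p μ →L[ℂ] Lp ℂ p μ)
    (hT : ∀ (m : ℕ) (y : Fin m → Lp ℂ p μ) (ε : ℝ), 0 < ε →
          ∃ S ∈ convexHull ℝ
              {S : Lp ℂ p μ →L[ℂ] Lp ℂ p μ | ‖S‖ ≤ 1 ∧ IsLamperti S},
            ∀ j : Fin m, ‖T (y j) - S (y j)‖ < ε)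
    (x : Lp ℂ p μ) :
    ‖HH m v (fun k => (T^k) x)‖ ≤ (3 * C)^(1/p.toReal) * ‖x‖ := by
  have h1 : (1:ℝ≥0∞) ≤ p := Fact.out
  have hp0 : p ≠ 0 := (zero_lt_one.trans_le h1).ne'
  have hP : 0 < p.toReal := ENNReal.toReal_pos hp0 hp'
  set D : ℝ := ∑ i ∈ range m, ‖v i‖ * i with hD
  have hD0 : 0 ≤ D := Finset.sum_nonneg fun i _ => by positivity
  refine le_of_forall_pos_le_add fun δ hδ => ?_
  obtain ⟨S, hS, hTS⟩ := hT m (fun j => (T^(j:ℕ)) x) (δ/(D+1)) (by positivity)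
  set ε := δ/(D+1) with hε
  have hSn := hull_norm S hS
  have hdist : ∀ k ≤ m, ‖(T^k) x - (S^k) x‖ ≤ k * ε := by
    intro k
    induction k with
    | zero => intro _; simp
    | succ k ih =>
      intro hk
      have i1 := ih (by omega)
      have i2 := (hTS ⟨k, by omega⟩).le
      have e : (T^(k+1)) x - (S^(k+1)) x =
          (T ((T^k) x) - S ((T^k) x)) + S ((T^k) x - (S^k) x) := by
        rw [pow_succ', pow_succ', map_sub]
        simp
      rw [e]
      refine (norm_add_le _ _).trans ?_
      have i3 : ‖S ((T^k) x - (S^k) x)‖ ≤ ‖(T^k) x - (S^k) x‖ := by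
        calc _ ≤ ‖S‖ * ‖(T^k) x - (S^k) x‖ := S.le_opNorm _
          _ ≤ 1 * ‖(T^k) x - (S^k) x‖ := by gcongr
          _ = _ := one_mul _
      rw [Nat.cast_succ, add_mul, one_mul]
      simp only at i2
      linarith
  have hS2 : ‖HH m v (fun k => (S^k) x)‖ ≤ (3 * C)^(1/p.toReal) * ‖x‖ := by
    have := mainS hp' hC m hm v e he hZ S hS x
    have h2 := Real.rpow_le_rpow (by positivity) this (show 0 ≤ 1/p.toReal by positivity)
    rw [Real.mul_rpow (by positivity) (by positivity), ← Real.rpow_mul (norm_nonneg _),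
      ← Real.rpow_mul (norm_nonneg _), mul_one_div_cancel hP.ne', Real.rpow_one,
      Real.rpow_one] at h2
    exact h2
  have hdiff : ‖HH m v (fun k => (T^k) x) - HH m v (fun k => (S^k) x)‖ ≤ δ := by
    have e : HH m v (fun k => (T^k) x) - HH m v (fun k => (S^k) x) =
        ∑ i ∈ range m, tn (v i) ((T^i) x - (S^i) x) := by
      simp only [HH, ← Finset.sum_sub_distrib, map_sub]
    rw [e]
    calc _ ≤ ∑ i ∈ range m, ‖tn (v i) ((T^i) x - (S^i) x)‖ := norm_sum_le _ _
      _ ≤ ∑ i ∈ range m, ‖v i‖ * i * ε := by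
          refine Finset.sum_le_sum fun i hi => ?_
          rw [norm_tn, mul_assoc]
          exact mul_le_mul_of_nonneg_left (hdist i (mem_range.1 hi).le) (norm_nonneg _)
      _ = D * ε := by rw [hD, Finset.sum_mul]
      _ ≤ δ := by
          rw [hε, mul_div_assoc', div_le_iff₀ (by positivity)]
          nlinarith
  have := norm_sub_norm_le (HH m v (fun k => (T^k) x)) (HH m v (fun k => (S^k) x))
  linarith

lemma sum_ind (z : ℕ → ℂ) (l m : ℕ) (hl : l < m) :
    ∑ i ∈ range m, z i * (((if i ≤ l then 1 / ((l : ℝ) + 1) else 0 : ℝ)) : ℂ) =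
      ((l:ℂ)+1)⁻¹ * ∑ i ∈ range (l+1), z i := by
  have : ∀ i ∈ range m, z i * (((if i ≤ l then 1 / ((l : ℝ) + 1) else 0 : ℝ)) : ℂ) =
      if i ≤ l then ((l:ℂ)+1)⁻¹ * z i else 0 := by
    intro i _; split_ifs
    · push_cast; ring
    · simp
  rw [Finset.sum_congr rfl this, ← Finset.sum_filter, Finset.mul_sum]
  congr 1
  ext i; simp only [mem_filter, mem_range]; omega

lemma erg_coe (T : Lp ℂ p μ →L[ℂ] Lp ℂ p μ) (n : ℕ) (x : Lp ℂ p μ) :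
    ∀ᵐ ω ∂μ, (ergAvg T n x) ω = ((n:ℂ)+1)⁻¹ * ∑ i ∈ range (n+1), ((T^i) x) ω := by
  have e : ergAvg T n x = ((n:ℂ)+1)⁻¹ • ∑ i ∈ range (n+1), (T^i) x := by
    rw [ergAvg]; simp
  rw [e]
  filter_upwards [Lp.coeFn_smul (((n:ℂ)+1)⁻¹) (∑ i ∈ range (n+1), (T^i) x),
    coe_sum (range (n+1)) (fun i => (T^i) x)] with ω a1 a2
  rw [a1, Pi.smul_apply, a2, smul_eq_mul]

lemma final_norm (T : Lp ℂ p μ →L[ℂ] Lp ℂ p μ) (N : ℕ) (n : ℕ → ℕ) (hn : StrictMono n)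
    (x : Lp ℂ p μ) :
    eLpNorm (fun ω => (∑ i ∈ Finset.range N,
        ‖(ergAvg T (n i) x) ω - (ergAvg T (n (i + 1)) x) ω‖ ^ 2 : ℝ) ^ (1 / 2 : ℝ)) p μ =
      ENNReal.ofReal ‖HH (n N + 1) (wv N n) (fun k => (T^k) x)‖ := by
  rw [Lp.norm_def, ENNReal.ofReal_toReal (Lp.eLpNorm_ne_top _)]
  apply eLpNorm_congr_norm_ae
  have h1 : ∀ᵐ ω ∂μ, ∀ j, (ergAvg T (n j) x) ω =
      ((n j:ℂ)+1)⁻¹ * ∑ i ∈ range (n j+1), ((T^i) x) ω := ae_all_iff.2 fun j => erg_coe T (n j) x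
  have h2 : ∀ᵐ ω ∂μ, ∀ i, tn (wv N n i) ((T^i) x) ω = ((T^i) x) ω • wv N n i :=
    ae_all_iff.2 fun i => tn_coe _ _
  filter_upwards [h1, h2, coe_sum (range (n N + 1)) (fun i => tn (wv N n i) ((T^i) x))]
    with ω a1 a2 a3
  rw [HH, a3]
  simp only [a1, a2]
  rw [EuclideanSpace.norm_eq, ← Real.sqrt_eq_rpow, Real.norm_of_nonneg (Real.sqrt_nonneg _)]
  congr 1
  rw [← Fin.sum_univ_eq_sum_range (fun i => ‖((n i:ℂ)+1)⁻¹ * ∑ l ∈ range (n i+1), ((T^l) x) ω -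
    ((n (i+1):ℂ)+1)⁻¹ * ∑ l ∈ range (n (i+1)+1), ((T^l) x) ω‖^2) N]
  refine Finset.sum_congr rfl fun j _ => ?_
  have l1 : n j < n N + 1 := by have := hn.monotone j.2.le; omega
  have l2 : n (j+1) < n N + 1 := by
    have := hn.monotone (show (j:ℕ) + 1 ≤ N from j.2); omega
  congr 2
  rw [← sum_ind _ _ _ l1, ← sum_ind _ _ _ l2, ← Finset.sum_sub_distrib]
  simp only [wv, wt, WithLp.ofLp_sum, Finset.sum_apply, smul_eq_mul,
    WithLp.ofLp_smul, Pi.smul_apply]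
  refine Finset.sum_congr rfl fun i _ => ?_
  push_cast
  ring

end finalsec
end QME

/-- Quantitative mean ergodic inequality for operators in the strong-operator-topology
closure of the convex hull of the Lamperti contractions on `L^p`, `2 ≤ p < ∞`
(commutative case of Theorem 1.3). -/
theorem quantitative_mean_ergodic_lamperti
    (p : ℝ≥0∞) [Fact (1 ≤ p)] (hp : 2 ≤ p) (hp' : p ≠ ∞) :
    ∃ C : ℝ, 0 < C ∧
      ∀ (X : Type) [MeasurableSpace X] (μ : Measure X) [SigmaFinite μ]
        (T : Lp ℂ p μ →L[ℂ] Lp ℂ p μ),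
        -- `T` lies in the SOT-closure of the convex hull of the Lamperti contractions:
        (∀ (m : ℕ) (y : Fin m → Lp ℂ p μ) (ε : ℝ), 0 < ε →
          ∃ S ∈ convexHull ℝ
              {S : Lp ℂ p μ →L[ℂ] Lp ℂ p μ | ‖S‖ ≤ 1 ∧ IsLamperti S},
            ∀ j : Fin m, ‖T (y j) - S (y j)‖ < ε) →
        ∀ (N : ℕ) (n : ℕ → ℕ), StrictMono n → (∀ i, 0 < n i) →
        ∀ x : Lp ℂ p μ,
          eLpNorm
            (fun ω => (∑ i ∈ Finset.range N,
                ‖(ergAvg T (n i) x) ω - (ergAvg T (n (i + 1)) x) ω‖ ^ 2 : ℝ)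
              ^ (1 / 2 : ℝ)) p μ
          ≤ ENNReal.ofReal (C * ‖x‖) := by
  have hP2 : 2 ≤ p.toReal := by
    have := ENNReal.toReal_mono hp' hp
    simpa using this
  obtain ⟨C, hC, H⟩ := QME.Zc hP2
  refine ⟨(3*C)^(1/p.toReal), by positivity, ?_⟩
  intro X _ μ _ T hT N n hn hpos x
  rcases Nat.eq_zero_or_pos N with rfl | hN
  · simp
  rw [QME.final_norm T N n hn x]
  refine ENNReal.ofReal_le_ofReal ?_
  exact QME.limT hp' hC (n N + 1) (Nat.succ_pos _) (QME.wv N n)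
    (EuclideanSpace.single ⟨0, hN⟩ (1:ℂ)) (by simp) (fun z => H N (n N + 1) n hn hpos z) T hT x
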